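/- arXiv:2309.06872 — 4 statements merged into one kernel-verified Lean document; each statement's English description precedes it below -/
import Mathlib

section
/- Let δ, δ', α, α' ∈ F_{q^2} with α ≠ 0 and α' ≠ 0. If P_{δ,α}(x) = P_{δ',α'}(x) as polynomials and (δ,α) ≠ (δ',α'), then P_{δ,α}(x) = (x − δ/3)^3. -/
noncomputable section

open Polynomial

/-- The cubic `P_{δ,α}(x) = x³ − δx² − (δα + 3α^{1−q})x − (δα²(1 − α^{−(q+1)})/3 + α^{2−q})`. -/
def Pda {F : Type*} [Field F] (q : ℕ) (δ α : F) : Polynomial F :=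
  X ^ 3 - C δ * X ^ 2 - C (δ * α + 3 * α ^ ((1 : ℤ) - q)) * X -
    C (δ * α ^ 2 * (1 - α ^ (-((q : ℤ) + 1))) / 3 + α ^ ((2 : ℤ) - q))

theorem three_ne_zero_of_card_eq_prime_pow {F : Type*} [Field F] [Fintype F] {p m : ℕ}
    (hp : p.Prime) (hp3 : 3 < p) (hF : Fintype.card F = p ^ m) : (3 : F) ≠ 0 := by
  intro h3
  have hcard : ((p ^ m : ℕ) : F) = 0 := hF ▸ FiniteField.cast_card_eq_zero F
  have hp0 : (p : F) = 0 := by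
    rw [Nat.cast_pow] at hcard
    exact eq_zero_of_pow_eq_zero hcard
  have hcop : IsCoprime (p : ℤ) ((3 : ℕ) : ℤ) :=
    Nat.isCoprime_iff_coprime.2 ((Nat.coprime_primes hp Nat.prime_three).2 hp3.ne')
  obtain ⟨a, b, hab⟩ := hcop
  have h := congrArg (Int.cast : ℤ → F) hab
  push_cast at h
  rw [hp0, h3] at h
  simp at h

/-- The constant coefficient of `Pda` is an affine function of `α` once `δ` and the linear
coefficient `u` are fixed. -/
theorem Pda_eq {F : Type*} [Field F] (h3 : (3 : F) ≠ 0) (q : ℕ) (δ : F) {α : F} (hα : α ≠ 0) :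
    ∃ u : F, Pda q δ α =
      X ^ 3 - C δ * X ^ 2 - C u * X - C ((α * (3 * u + δ ^ 2) - δ * u) / 9) := by
  have h9 : (9 : F) ≠ 0 := by
    rw [show (9 : F) = 3 * 3 by norm_num]
    exact mul_ne_zero h3 h3
  refine ⟨δ * α + 3 * α ^ ((1 : ℤ) - q), ?_⟩
  unfold Pda
  congr 2
  rw [neg_add, zpow_add₀ hα, sub_eq_add_neg, sub_eq_add_neg (2 : ℤ), sub_eq_add_neg (1 : ℤ),
    zpow_add₀ hα, zpow_add₀ hα, zpow_neg_one, zpow_one, zpow_ofNat]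
  generalize α ^ (-(q : ℤ)) = c
  field_simp
  ring

theorem cubic_coeffs_eq {R : Type*} [CommRing R] {a b c a' b' c' : R}
    (h : (X ^ 3 - C a * X ^ 2 - C b * X - C c : R[X]) =
      X ^ 3 - C a' * X ^ 2 - C b' * X - C c') : a = a' ∧ b = b' ∧ c = c' := by
  refine ⟨?_, ?_, ?_⟩
  · simpa [coeff_X, coeff_C, coeff_X_pow] using congrArg (coeff · 2) h
  · simpa [coeff_X, coeff_C, coeff_X_pow] using congrArg (coeff · 1) h
  · simpa [coeff_X, coeff_C, coeff_X_pow] using congrArg (coeff · 0) h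

/-- Lemma: if `P_{δ,α} = P_{δ',α'}` with `(δ,α) ≠ (δ',α')` (and `α, α' ≠ 0`), then
`P_{δ,α}(x) = (x − δ/3)³`. -/
theorem statement15 (p n q : ℕ) (hp : p.Prime) (hp3 : 3 < p) (hn : n ≠ 0) (hq : q = p ^ n)
    (F : Type*) [Field F] [Fintype F] (hF : Fintype.card F = q ^ 2)
    (δ δ' α α' : F) (hα : α ≠ 0) (hα' : α' ≠ 0)
    (heq : Pda q δ α = Pda q δ' α') (hne : (δ, α) ≠ (δ', α')) :
    Pda q δ α = (X - C (δ / 3)) ^ 3 := by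
  have h3 : (3 : F) ≠ 0 :=
    three_ne_zero_of_card_eq_prime_pow hp hp3 (m := n * 2) (by rw [hF, hq, pow_mul])
  have h9 : (9 : F) ≠ 0 := by
    rw [show (9 : F) = 3 * 3 by norm_num]
    exact mul_ne_zero h3 h3
  obtain ⟨u, hu⟩ := Pda_eq h3 q δ hα
  obtain ⟨u', hu'⟩ := Pda_eq h3 q δ' hα'
  rw [hu, hu'] at heq
  obtain ⟨rfl, rfl, hc⟩ := cubic_coeffs_eq heq
  have hαα' : α - α' ≠ 0 := fun h => hne (by rw [sub_eq_zero.1 h])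
  rw [div_left_inj' h9] at hc
  have hmul : (α - α') * (3 * u + δ ^ 2) = 0 := by linear_combination hc
  have hzero := (mul_eq_zero.1 hmul).resolve_left hαα'
  obtain ⟨e, rfl⟩ : ∃ e, δ = 3 * e := ⟨δ / 3, (mul_div_cancel₀ δ h3).symm⟩
  have hue : u = -(3 * e ^ 2) := mul_left_cancel₀ h3 (by linear_combination hzero)
  have hconst : (α * (3 * u + (3 * e) ^ 2) - 3 * e * u) / 9 = e ^ 3 := by
    rw [hzero, hue, div_eq_iff h9]
    ring
  rw [hu, hconst, hue, mul_div_cancel_left₀ e h3]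
  simp only [map_neg, map_mul, map_pow, map_ofNat]
  ring
end
end

section
/- The number of monic irreducible cubic polynomials in F_{q^2}[x] satisfying Condition (1) equals q(q−1)^2(q+1)/3 if q ≡ 1 (mod 3), and q(q−1)(q+1)^2/3 if q ≡ 2 (mod 3). -/
noncomputable section

open Polynomial

/-- A polynomial `P` over `F = 𝔽_{q²}`, of degree `m`, satisfies Condition (1). -/
def Condition1 {F : Type*} [Field F] (q m : ℕ) (P : Polynomial F) : Prop :=
  ∀ x y : F, x ≠ 0 → y ≠ 0 →
    (x ^ m * P.eval (x ^ (q - 1))) * (y ^ m * P.eval (y ^ (q - 1))) ^ q =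
      (x ^ m * P.eval (x ^ (q - 1))) ^ q * (y ^ m * P.eval (y ^ (q - 1))) →
    x * y ^ q = x ^ q * y

/-- Two polynomials of degree less than the characteristic with vanishing Wronskian are
proportional. -/
theorem exists_eq_C_mul_of_derivative_mul_eq {F : Type*} [Field F] (p : ℕ) [CharP F p]
    {f g : F[X]} (hf : f.natDegree < p) (hg : g.natDegree < p) (hg0 : g ≠ 0)
    (h : derivative f * g = f * derivative g) : ∃ c : F, f = C c * g := by
  have natDegree_eq : ∀ f : F[X], f.natDegree < p → f ≠ 0 →
      derivative f * g = f * derivative g → f.natDegree = g.natDegree := by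
    intro f hf hf0 h
    have key := congrArg (fun r => coeff (X * r) (f.natDegree + g.natDegree)) h
    have h1 : X * (derivative f * g) = (X * derivative f) * g := by ring
    have h2 : X * (f * derivative g) = f * (X * derivative g) := by ring
    have hX : ∀ r : F[X], (X * derivative r).natDegree ≤ r.natDegree := by
      intro r
      rw [natDegree_le_iff_coeff_eq_zero]
      intro N hN
      cases N with
      | zero => simp
      | succ N => rw [coeff_X_mul, coeff_derivative, coeff_eq_zero_of_natDegree_lt hN, zero_mul]
    have hc : ∀ r : F[X], (X * derivative r).coeff r.natDegree =
        r.natDegree * r.coeff r.natDegree := by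
      intro r
      cases hr : r.natDegree with
      | zero => simp
      | succ N => rw [coeff_X_mul, coeff_derivative]; push_cast; ring
    simp only [h1, h2] at key
    rw [coeff_mul_add_eq_of_natDegree_le (hX f) le_rfl, coeff_mul_add_eq_of_natDegree_le le_rfl (hX g),
      hc, hc] at key
    have hfl : f.coeff f.natDegree ≠ 0 := leadingCoeff_ne_zero.2 hf0
    have hgl : g.coeff g.natDegree ≠ 0 := leadingCoeff_ne_zero.2 hg0
    have hcast : (f.natDegree : F) = g.natDegree := by
      apply mul_right_cancel₀ (mul_ne_zero hfl hgl)
      linear_combination key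
    rw [CharP.natCast_eq_natCast F p] at hcast
    rwa [Nat.ModEq, Nat.mod_eq_of_lt hf, Nat.mod_eq_of_lt hg] at hcast
  by_cases hf0 : f = 0
  · exact ⟨0, by simp [hf0]⟩
  have hd := natDegree_eq f hf hf0 h
  refine ⟨f.leadingCoeff / g.leadingCoeff, ?_⟩
  set c := f.leadingCoeff / g.leadingCoeff with hc
  have hgl : g.leadingCoeff ≠ 0 := leadingCoeff_ne_zero.2 hg0
  have hle : (f - C c * g).natDegree ≤ g.natDegree :=
    (natDegree_sub_le _ _).trans (max_le hd.le (natDegree_C_mul_le _ _))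
  have hlead : (f - C c * g).coeff g.natDegree = 0 := by
    rw [coeff_sub, coeff_C_mul]
    nth_rewrite 1 [← hd]
    rw [coeff_natDegree, coeff_natDegree, hc, div_mul_cancel₀ _ hgl, sub_self]
  by_contra hne
  have hne' : f - C c * g ≠ 0 := sub_ne_zero.2 hne
  have := natDegree_eq (f - C c * g) (hle.trans_lt hg) hne' (by
    simp only [derivative_sub, derivative_C_mul]
    linear_combination h)
  rw [← this, coeff_natDegree, leadingCoeff_eq_zero] at hlead
  exact hne' hlead

theorem natDegree_X_mul_derivative_le {F : Type*} [Field F] (f : F[X]) :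
    (X * derivative f).natDegree ≤ f.natDegree := by
  rw [natDegree_le_iff_coeff_eq_zero]
  intro N hN
  cases N with
  | zero => simp
  | succ N => rw [coeff_X_mul, coeff_derivative, coeff_eq_zero_of_natDegree_lt hN, zero_mul]

theorem exists_natDegree_le_quartic_operator {F : Type*} [Field F] (D S : F[X])
    (hD : D.natDegree ≤ 4) (hS : S.natDegree ≤ 2) (h0 : S.coeff 0 = 2 * D.coeff 0) :
    ∃ G : F[X], G.natDegree ≤ 5 ∧
      4 * D * S - (2 * D + X * derivative D) * (4 * D - X * derivative D) +
        2 * D * (4 * (X * derivative D) - X * derivative (X * derivative D)) = X * G := by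
  rw [as_sum_range_C_mul_X_pow' D (n := 5) (by omega),
    as_sum_range_C_mul_X_pow' S (n := 3) (by omega)]
  simp only [Finset.sum_range_succ, Finset.sum_range_zero, h0]
  generalize D.coeff 0 = d0
  generalize D.coeff 1 = d1
  generalize D.coeff 2 = d2
  generalize D.coeff 3 = d3
  generalize D.coeff 4 = d4
  generalize S.coeff 1 = s1
  generalize S.coeff 2 = s2
  refine ⟨C (4 * (d0 * s1 + 2 * d1 * d0) - 12 * d0 * d1) +
    C (4 * (d0 * s2 + d1 * s1 + 2 * d0 * d2) - 12 * d0 * d2 - 3 * d1 ^ 2) * X +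
    C (4 * (d1 * s2 + d2 * s1 + 2 * d0 * d3) - 16 * d0 * d3 - 4 * d1 * d2) * X ^ 2 +
    C (4 * (d2 * s2 + d3 * s1 + 2 * d0 * d4) - 24 * d0 * d4 - 6 * d1 * d3) * X ^ 3 +
    C (4 * (d3 * s2 + d4 * s1) - 12 * d1 * d4) * X ^ 4 +
    C (4 * d4 * s2 - 4 * d2 * d4 + d3 ^ 2) * X ^ 5, ?_, ?_⟩
  · compute_degree
  · simp only [derivative_add, derivative_mul, derivative_C, derivative_X_pow, derivative_X,
      C_add, C_sub, C_mul, C_pow, map_ofNat, Nat.cast_ofNat]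
    simp
    have h2 : (C 2 : F[X]) = 2 := map_ofNat C 2
    have h3 : (C 3 : F[X]) = 3 := map_ofNat C 3
    rw [h2, h3]
    ring

/-- The differential-equation step of Stepanov's method on the norm-one group: if `u² D(u)^m`
takes the value `1` at all `(2m+2)`-th roots of unity, where `2m + 1 = 0` in `F` and `D` has
degree at most four, then `D` is a constant multiple of a square. -/
theorem exists_eq_C_mul_sq_of_dvd {F : Type*} [Field F] (p : ℕ) [CharP F p] (hp5 : 5 ≤ p)
    (m : ℕ) (hm : 2 ≤ m) (hm0 : 2 * (m : F) + 1 = 0) (D : F[X]) (hD : D.natDegree ≤ 4)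
    (hdvd : (X ^ (2 * m + 2) - 1 : F[X]) ∣ X ^ 2 * D ^ m - 1) :
    ∃ (c : F) (M : F[X]), M.natDegree ≤ 2 ∧ D = C c * M ^ 2 := by
  have hcast : ∀ k : ℕ, 0 < k → k < p → (k : F) ≠ 0 := by
    intro k hk hkp h
    exact absurd (Nat.le_of_dvd hk ((CharP.cast_eq_zero_iff F p k).1 h)) (by omega)
  have h2 : (2 : F) ≠ 0 := by exact_mod_cast hcast 2 (by omega) (by omega)
  have h2P : (2 : F[X]) ≠ 0 := by
    rw [← map_ofNat C 2]
    exact C_ne_zero.2 h2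
  by_cases hD0 : D = 0
  · exact ⟨0, 0, by simp, by simp [hD0]⟩
  obtain ⟨R, hR⟩ := hdvd
  set T : F[X] := X ^ (2 * m + 2) - 1 with hT
  have hTdeg : T.natDegree = 2 * m + 2 := by
    rw [hT, ← C_1, natDegree_X_pow_sub_C]
  have hT0 : T ≠ 0 := by
    intro h
    rw [h, natDegree_zero] at hTdeg
    omega
  have hTc : T.coeff 0 = -1 := by simp [hT, coeff_X_pow]
  have hmP : (2 * (m : F[X]) + 1) = 0 := by
    have := congrArg (C : F → F[X]) hm0
    simpa only [C_add, C_mul, map_ofNat, map_natCast, C_1, C_0] using this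
  have hT' : X * derivative T = T + 1 := by
    simp only [hT, derivative_sub, derivative_X_pow, derivative_one, sub_zero]
    have : (C ((2 * m + 2 : ℕ) : F) : F[X]) = 1 := by
      push_cast
      rw [← C_1]
      congr 1
      linear_combination hm0
    rw [this, show 2 * m + 2 - 1 = 2 * m + 1 by omega]
    ring
  have hR0 : R.coeff 0 = 1 := by
    have := congrArg (fun r => coeff r 0) hR
    simp only [mul_coeff_zero, hTc, coeff_sub, coeff_one_zero, coeff_X_pow] at this
    norm_num at this
    exact this.symm
  have hRdeg : R.natDegree ≤ 2 * m := by
    by_cases hR0 : R = 0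
    · simp [hR0]
    have h1 : (T * R).natDegree ≤ 4 * m + 2 := by
      rw [← hR]
      refine (natDegree_sub_le _ _).trans (max_le ?_ (by simp))
      refine natDegree_mul_le.trans ?_
      have := natDegree_pow_le_of_le m hD
      rw [natDegree_X_pow]
      omega
    rw [natDegree_mul hT0 hR0, hTdeg] at h1
    omega
  have hθD := natDegree_X_mul_derivative_le D
  have h2D : (2 * D).natDegree ≤ D.natDegree := by
    rw [← map_ofNat C 2]
    exact natDegree_C_mul_le _ _
  have h4D : (4 * D).natDegree ≤ D.natDegree := by
    rw [← map_ofNat C 4]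
    exact natDegree_C_mul_le _ _
  obtain ⟨W, hW⟩ : ∃ W : F[X], W = 4 * D - X * derivative D := ⟨_, rfl⟩
  have hWdeg : W.natDegree ≤ D.natDegree := by
    rw [hW]
    exact (natDegree_sub_le _ _).trans (max_le h4D hθD)
  obtain ⟨S, hS⟩ : ∃ S : F[X], S = W * R - 2 * D * R - 2 * D * (X * derivative R) := ⟨_, rfl⟩
  have hθR : 2 * D * (X * derivative R) = W * R - 2 * D * R - S := by
    linear_combination hS
  have eq1 : 2 * D * R - W = T * S := by
    have hy := congrArg (fun r => 2 * D * (X * derivative r)) hR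
    obtain ⟨k, rfl⟩ : ∃ k, m = k + 1 := ⟨m - 1, by omega⟩
    simp only [derivative_sub, derivative_mul, derivative_pow, derivative_one, derivative_X,
      sub_zero, Nat.add_sub_cancel, map_natCast] at hy
    push_cast at hmP hy
    rw [hS, hW]
    linear_combination (-hy + (4 * D - X * derivative D) * hR -
      2 * D * R * hT' + hmP * (X ^ 3 * D ^ (k + 1) * derivative D))
  have hSdeg : S.natDegree ≤ 2 := by
    by_cases hS0 : S = 0
    · simp [hS0]
    have h1 : (T * S).natDegree ≤ 2 * m + 4 := by
      rw [← eq1]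
      refine (natDegree_sub_le _ _).trans (max_le ?_ (by omega))
      refine natDegree_mul_le.trans ?_
      omega
    rw [natDegree_mul hT0 hS0, hTdeg] at h1
    omega
  have hS0 : S.coeff 0 = 2 * D.coeff 0 := by
    have := congrArg (fun r => coeff r 0) eq1
    simp only [mul_coeff_zero, hTc, coeff_sub, hR0, hW, coeff_ofNat_zero, coeff_X_zero] at this
    linear_combination this
  obtain ⟨G, hGdeg, hG⟩ := exists_natDegree_le_quartic_operator D S hD hSdeg hS0
  obtain ⟨E, hE⟩ : ∃ E : F[X], E = X * derivative D * S - 2 * D * (X * derivative S) := ⟨_, rfl⟩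
  have eq2 : T * E = X * G := by
    have hd := congrArg (fun r => X * derivative r) eq1
    simp only [derivative_sub, derivative_mul, derivative_ofNat, zero_mul, zero_add] at hd
    have hW' : X * derivative W = 4 * (X * derivative D) - X * derivative (X * derivative D) := by
      rw [hW]
      simp only [derivative_sub, derivative_mul, derivative_ofNat, zero_mul, zero_add]
      ring
    rw [← hG, hE, ← hW']
    linear_combination -2 * D * hS + 2 * D * hd + 2 * D * S * hT' -
      (W - 2 * D + 2 * (X * derivative D)) * eq1 -
      (W + (4 * D - X * derivative D) - 2 * D + 2 * (X * derivative D) + T * S) * hW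
  have hE0 : E = 0 := by
    by_contra hE0
    have hG0 : G ≠ 0 := by
      rintro rfl
      rw [mul_zero] at eq2
      exact (mul_ne_zero hT0 hE0) eq2
    have h1 := congrArg natDegree eq2
    rw [natDegree_mul hT0 hE0, natDegree_mul X_ne_zero hG0, natDegree_X, hTdeg] at h1
    have h2 := congrArg (fun r => coeff r 0) eq2
    simp only [mul_coeff_zero, hTc, coeff_X_zero, zero_mul, neg_mul, one_mul, neg_eq_zero] at h2
    rw [eq_C_of_natDegree_le_zero (p := E) (by omega), h2, C_0] at hE0
    exact hE0 rfl
  by_cases hSz : S = 0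
  · have hRdeg0 : R.natDegree ≤ 0 := by
      have hR00 : R ≠ 0 := by
        rintro rfl
        simp at hR0
      have h1 := congrArg natDegree (show 2 * (D * R) = W by linear_combination eq1 + T * hSz)
      rw [natDegree_mul h2P (mul_ne_zero hD0 hR00), natDegree_mul hD0 hR00] at h1
      omega
    have hR1 : R = 1 := by rw [eq_C_of_natDegree_le_zero hRdeg0, hR0, C_1]
    have hDeq : X * derivative D = 2 * D := by
      rw [hSz, hR1, hW] at eq1
      linear_combination eq1
    refine ⟨D.coeff 2, X, by simp, ?_⟩
    have hco : ∀ k : ℕ, ((k : F) - 2) * D.coeff k = 0 := by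
      intro k
      have := congrArg (fun r => coeff r k) hDeq
      simp only [← map_ofNat C 2, coeff_C_mul] at this
      cases k with
      | zero => simpa using this
      | succ k =>
        rw [coeff_X_mul, coeff_derivative] at this
        push_cast
        linear_combination this
    ext k
    rw [coeff_C_mul, coeff_X_pow]
    split_ifs with hk
    · rw [hk, mul_one]
    · rw [mul_zero]
      by_cases hk4 : 4 < k
      · exact coeff_eq_zero_of_natDegree_lt (by omega)
      refine (mul_eq_zero.1 (hco k)).resolve_left ?_
      intro h
      have : ((k : ℕ) : F) = (2 : ℕ) := by push_cast; linear_combination h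
      rw [CharP.natCast_eq_natCast F p, Nat.ModEq, Nat.mod_eq_of_lt (by omega),
        Nat.mod_eq_of_lt (by omega)] at this
      exact hk this
  · have hS2 : (S ^ 2).natDegree ≤ 4 := natDegree_pow_le_of_le 2 hSdeg
    obtain ⟨c, hc⟩ := exists_eq_C_mul_of_derivative_mul_eq p (f := D) (g := S ^ 2) (by omega)
      (by omega) (pow_ne_zero 2 hSz) (by
        rw [hE] at hE0
        apply mul_left_cancel₀ (X_ne_zero (R := F))
        rw [derivative_pow]
        simp only [Nat.cast_ofNat, map_ofNat]
        linear_combination S * hE0)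
    exact ⟨c, S, hSdeg, hc⟩

/-- `σ` is the `(2m+1)`-power Frobenius of a field with `(2m+1)²` elements, of characteristic
`p ≥ 5`. -/
structure IsQuadraticFrobenius {F : Type*} [Field F] (p m : ℕ) (σ : F →+* F) : Prop where
  charP : CharP F p
  five_le : 5 ≤ p
  two_le : 2 ≤ m
  exists_pow : ∃ n : ℕ, 2 * m + 1 = p ^ n
  prime : p.Prime
  apply (x : F) : σ x = x ^ (2 * m + 1)
  involutive (x : F) : σ (σ x) = x
  exists_primitive : ∃ ζ : F, IsPrimitiveRoot ζ (2 * m + 2)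
  isSquare_of_fixed (x : F) : σ x = x → ∃ t, x = t ^ 2

namespace IsQuadraticFrobenius

variable {F : Type*} [Field F] {p m : ℕ} {σ : F →+* F}

theorem natCast_ne_zero (h : IsQuadraticFrobenius p m σ) {k : ℕ} (hk : 0 < k) (hkp : k < p) :
    (k : F) ≠ 0 := by
  have := h.charP
  intro h0
  exact absurd (Nat.le_of_dvd hk ((CharP.cast_eq_zero_iff F p k).1 h0)) (by omega)

theorem two_ne_zero (h : IsQuadraticFrobenius p m σ) : (2 : F) ≠ 0 := by
  have := h.five_le
  exact_mod_cast h.natCast_ne_zero (k := 2) (by omega) (by omega)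

theorem three_ne_zero (h : IsQuadraticFrobenius p m σ) : (3 : F) ≠ 0 := by
  have := h.five_le
  exact_mod_cast h.natCast_ne_zero (k := 3) (by omega) (by omega)

theorem exponent_ne_zero (h : IsQuadraticFrobenius p m σ) :
    ∃ n : ℕ, n ≠ 0 ∧ 2 * m + 1 = p ^ n := by
  obtain ⟨n, hn⟩ := h.exists_pow
  refine ⟨n, ?_, hn⟩
  rintro rfl
  have := h.two_le
  simp at hn
  omega

theorem cast_eq_zero (h : IsQuadraticFrobenius p m σ) : 2 * (m : F) + 1 = 0 := by
  have := h.charP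
  obtain ⟨n, hn0, hn⟩ := h.exponent_ne_zero
  have : ((2 * m + 1 : ℕ) : F) = 0 := by
    rw [CharP.cast_eq_zero_iff F p, hn]
    exact dvd_pow_self p hn0
  exact_mod_cast this

theorem mul_apply_eq_one_iff (h : IsQuadraticFrobenius p m σ) {u : F} :
    u * σ u = 1 ↔ u ^ (2 * m + 2) = 1 := by
  rw [h.apply, ← pow_succ']

theorem dvd_of_forall_eval (h : IsQuadraticFrobenius p m σ) {f : F[X]}
    (hf : ∀ u, u * σ u = 1 → f.eval u = 0) : (X ^ (2 * m + 2) - 1 : F[X]) ∣ f := by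
  obtain ⟨ζ, hζ⟩ := h.exists_primitive
  rw [X_pow_sub_one_eq_prod (by omega) hζ]
  refine Finset.prod_dvd_of_coprime ?_ ?_
  · intro x _ y _ hxy
    exact pairwise_coprime_X_sub_C Function.injective_id hxy
  · intro u hu
    rw [dvd_iff_isRoot]
    exact hf u (h.mul_apply_eq_one_iff.2 ((mem_nthRootsFinset (by omega) 1).1 hu))

theorem sq_dvd_of_isRoot_derivative {f : F[X]} {u : F} (h0 : f.eval u = 0)
    (h1 : (derivative f).eval u = 0) : (X - C u) ^ 2 ∣ f := by
  obtain ⟨g, rfl⟩ := dvd_iff_isRoot.2 h0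
  rw [sq]
  refine mul_dvd_mul_left _ (dvd_iff_isRoot.2 ?_)
  simpa using h1

theorem natDegree_X_pow_sub_one : (X ^ (2 * m + 2) - 1 : F[X]).natDegree = 2 * m + 2 := by
  rw [← C_1, natDegree_X_pow_sub_C]

theorem exists_eval_ne_zero (h : IsQuadraticFrobenius p m σ) {f : F[X]} (hf : f ≠ 0)
    (hdeg : f.natDegree < 2 * m + 2) : ∃ u, u * σ u = 1 ∧ f.eval u ≠ 0 := by
  by_contra! hcon
  have := natDegree_le_of_dvd (h.dvd_of_forall_eval hcon) hf
  rw [natDegree_X_pow_sub_one] at this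
  omega

theorem X_sub_C_pow (h : IsQuadraticFrobenius p m σ) (u : F) :
    (X - C u : F[X]) ^ (2 * m + 1) = X ^ (2 * m + 1) - C (σ u) := by
  have := h.charP
  have := Fact.mk h.prime
  obtain ⟨n, hn⟩ := h.exists_pow
  rw [h.apply, C_pow, hn, sub_pow_char_pow]

/-- If every zero on the norm-one group of a polynomial `D` of degree at most four is a double
zero, and `D(u)/u²` is a nonzero square in the fixed field of `σ` at all other points of the
norm-one group, then `D` is a square. -/
theorem exists_eq_C_mul_sq (h : IsQuadraticFrobenius p m σ) {D : F[X]} (hD : D.natDegree ≤ 4)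
    (hroot : ∀ u, u * σ u = 1 → D.eval u = 0 → (X - C u) ^ 2 ∣ D)
    (hval : ∀ u, u * σ u = 1 → D.eval u ≠ 0 → u ^ 2 * D.eval u ^ m = 1) :
    ∃ (c : F) (M : F[X]), M.natDegree ≤ 2 ∧ D = C c * M ^ 2 := by
  have := h.charP
  have hm := h.two_le
  by_cases hD0 : D = 0
  · exact ⟨0, 0, by simp, by simp [hD0]⟩
  have of_sq_dvd : ∀ M : F[X], M.Monic → M.natDegree = 2 → M ^ 2 ∣ D →
      ∃ (c : F) (M : F[X]), M.natDegree ≤ 2 ∧ D = C c * M ^ 2 := by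
    rintro M hM hM2 ⟨Q, hQ⟩
    have hQ0 : Q ≠ 0 := by
      rintro rfl
      exact hD0 (by rw [hQ, mul_zero])
    have : Q.natDegree ≤ 0 := by
      rw [hQ, natDegree_mul (pow_ne_zero 2 hM.ne_zero) hQ0, natDegree_pow, hM2] at hD
      omega
    refine ⟨Q.coeff 0, M, hM2.le, ?_⟩
    rw [← eq_C_of_natDegree_le_zero this, hQ, mul_comm]
  by_cases hex : ∃ u₀, u₀ * σ u₀ = 1 ∧ D.eval u₀ = 0
  swap
  · push Not at hex
    refine exists_eq_C_mul_sq_of_dvd p h.five_le m hm h.cast_eq_zero D hD ?_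
    refine h.dvd_of_forall_eval fun u hu => ?_
    simp [hval u hu (hex u hu)]
  obtain ⟨u₀, hu₀, hDu₀⟩ := hex
  by_cases hex1 : ∃ u₁, u₁ ≠ u₀ ∧ u₁ * σ u₁ = 1 ∧ D.eval u₁ = 0
  · obtain ⟨u₁, hne, hu₁, hDu₁⟩ := hex1
    refine of_sq_dvd ((X - C u₀) * (X - C u₁)) ((monic_X_sub_C _).mul (monic_X_sub_C _)) ?_ ?_
    · rw [natDegree_mul (X_sub_C_ne_zero _) (X_sub_C_ne_zero _), natDegree_X_sub_C,
        natDegree_X_sub_C]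
    · rw [mul_pow]
      refine IsCoprime.mul_dvd ?_ (hroot u₀ hu₀ hDu₀) (hroot u₁ hu₁ hDu₁)
      exact (pairwise_coprime_X_sub_C Function.injective_id hne.symm).pow
  push Not at hex1
  obtain ⟨D₀, hD₀⟩ := hroot u₀ hu₀ hDu₀
  have hu₀0 : u₀ ≠ 0 := left_ne_zero_of_mul_eq_one hu₀
  have hD₀0 : D₀ ≠ 0 := by
    rintro rfl
    exact hD0 (by rw [hD₀, mul_zero])
  have hD₀deg : D₀.natDegree ≤ 2 := by
    rw [hD₀, natDegree_mul (pow_ne_zero 2 (X_sub_C_ne_zero _)) hD₀0, natDegree_pow,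
      natDegree_X_sub_C] at hD
    omega
  have hdvd : (X ^ (2 * m + 2) - 1 : F[X]) ∣ (X - C u₀) * (X * D₀ ^ m + C u₀) := by
    refine h.dvd_of_forall_eval fun u hu => ?_
    by_cases huu : u = u₀
    · simp [huu]
    have hv := hval u hu (hex1 u huu hu)
    rw [hD₀] at hv
    simp only [eval_mul, eval_pow, eval_sub, eval_X, eval_C, eval_add] at hv ⊢
    have hs : (u - u₀) * ((u - u₀) ^ (2 * m) * u * u₀ + 1) = 0 := by
      have h1 : (u - u₀) ^ (2 * m + 1) = σ u - σ u₀ := by rw [← h.apply, map_sub]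
      linear_combination u * u₀ * h1 + u₀ * hu - u * hu₀
    have hs' := (mul_eq_zero.1 hs).resolve_left (sub_ne_zero.2 huu)
    rw [mul_pow, ← pow_mul] at hv
    linear_combination (u - u₀) * (-u₀ * hv + u * eval u D₀ ^ m * hs')
  obtain ⟨K, hK⟩ := hdvd
  have hKdeg : K.natDegree ≤ 0 := by
    by_cases hK0 : K = 0
    · simp [hK0]
    have h1 : ((X - C u₀) * (X * D₀ ^ m + C u₀)).natDegree ≤ 2 * m + 2 := by
      have h2 := natDegree_pow_le_of_le m hD₀deg
      have h3 : (X * D₀ ^ m).natDegree ≤ 2 * m + 1 := by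
        refine natDegree_mul_le.trans ?_
        rw [natDegree_X]
        omega
      have h4 := natDegree_add_le_of_degree_le h3 (natDegree_C u₀ |>.le.trans (Nat.zero_le _))
      refine natDegree_mul_le.trans ?_
      rw [natDegree_X_sub_C]
      omega
    rw [hK, natDegree_mul _ hK0, natDegree_X_pow_sub_one] at h1
    · omega
    · intro h0
      have := natDegree_X_pow_sub_one (F := F) (m := m)
      rw [h0, natDegree_zero] at this
      omega
  rw [eq_C_of_natDegree_le_zero hKdeg] at hK
  have hk : K.coeff 0 = u₀ ^ 2 := by
    have := congrArg (eval 0) hK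
    simp at this
    linear_combination -this
  rw [hk] at hK
  have hmain : D₀ ^ m = C (u₀ ^ 2) * ((X - C u₀) ^ 2) ^ m := by
    apply mul_left_cancel₀ (mul_ne_zero (X_sub_C_ne_zero u₀) (X_ne_zero (R := F)))
    have h1 := h.X_sub_C_pow u₀
    have h2 : (C u₀ * C (σ u₀) : F[X]) = 1 := by rw [← C_mul, hu₀, C_1]
    rw [← pow_mul]
    rw [C_pow] at hK ⊢
    linear_combination hK - C u₀ ^ 2 * X * h1 + C u₀ * X * h2
  have hdvd₀ : (X - C u₀) ^ 2 ∣ D₀ := by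
    rw [← IsIntegrallyClosed.pow_dvd_pow_iff (n := m) (by omega), hmain]
    exact dvd_mul_left _ _
  refine of_sq_dvd ((X - C u₀) ^ 2) ((monic_X_sub_C _).pow 2) ?_ ?_
  · rw [natDegree_pow, natDegree_X_sub_C]
  · rw [sq ((X - C u₀) ^ 2), hD₀]
    exact mul_dvd_mul_left _ hdvd₀

/-- A symmetric self-conjugate form of bidegree `(2, 2)` without off-diagonal zeros on the
norm-one group has square discriminant. -/
theorem exists_discrim_eq_sq (h : IsQuadraticFrobenius p m σ) (a b c e : F) (hc : σ c = c)
    (he : σ e = e)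
    (H : ∀ u v, u * σ u = 1 → v * σ v = 1 →
      a * u ^ 2 * v ^ 2 + b * u * v * (u + v) + c * (u ^ 2 + v ^ 2) + e * u * v +
        σ b * (u + v) + σ a = 0 → u = v) :
    ∃ M : F[X], M.natDegree ≤ 2 ∧
      (C b * X ^ 2 + C e * X + C (σ b)) ^ 2 -
        4 * (C a * X ^ 2 + C b * X + C c) * (C c * X ^ 2 + C (σ b) * X + C (σ a)) = M ^ 2 := by
  have := h.charP
  have hm := h.two_le
  have h2 := h.two_ne_zero
  obtain ⟨D, hD⟩ : ∃ D : F[X], D = (C b * X ^ 2 + C e * X + C (σ b)) ^ 2 -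
    4 * (C a * X ^ 2 + C b * X + C c) * (C c * X ^ 2 + C (σ b) * X + C (σ a)) := ⟨_, rfl⟩
  have heval : ∀ u, D.eval u = (b * u ^ 2 + e * u + σ b) ^ 2 -
      4 * (a * u ^ 2 + b * u + c) * (c * u ^ 2 + σ b * u + σ a) := by
    intro u
    rw [hD]
    simp
  have hDdeg : D.natDegree ≤ 4 := by
    rw [hD]
    compute_degree
  have hnonzero : ∀ u, u * σ u = 1 → ¬ (a * u ^ 2 + b * u + c = 0 ∧ b * u ^ 2 + e * u + σ b = 0 ∧
      c * u ^ 2 + σ b * u + σ a = 0) := by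
    rintro u hu ⟨hA, hB, hE⟩
    obtain ⟨v, hv, hne⟩ := h.exists_eval_ne_zero (X_sub_C_ne_zero u)
      (by rw [natDegree_X_sub_C]; omega)
    rw [eval_sub, eval_X, eval_C] at hne
    refine hne (sub_eq_zero.2 (H u v hu hv ?_).symm)
    linear_combination v ^ 2 * hA + v * hB + hE
  have hconj : ∀ u, u * σ u = 1 →
      σ (a * u ^ 2 + b * u + c) * u ^ 2 = c * u ^ 2 + σ b * u + σ a := by
    intro u hu
    simp only [map_add, map_mul, map_pow, hc]
    linear_combination (σ a * (u * σ u + 1) + σ b * u) * hu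
  have hconjB : ∀ u, u * σ u = 1 →
      σ (b * u ^ 2 + e * u + σ b) * u ^ 2 = b * u ^ 2 + e * u + σ b := by
    intro u hu
    simp only [map_add, map_mul, map_pow, he, h.involutive]
    linear_combination (σ b * (u * σ u + 1) + e * u) * hu
  have hfix : ∀ u, u * σ u = 1 → σ (D.eval u * σ u ^ 2) = D.eval u * σ u ^ 2 := by
    intro u hu
    have hA := hconj u hu
    have hB := hconjB u hu
    rw [heval]
    set A := a * u ^ 2 + b * u + c
    set B := b * u ^ 2 + e * u + σ b
    rw [← hA]
    have h4 : σ (4 : F) = 4 := map_ofNat σ 4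
    simp only [map_sub, map_mul, map_pow, h.involutive, h4]
    have hB' : σ B = B * σ u ^ 2 := by
      linear_combination σ u ^ 2 * hB - σ B * (u * σ u + 1) * hu
    rw [hB']
    linear_combination B ^ 2 * σ u ^ 2 * (u * σ u + 1) * hu
  have hsq : ∀ u, u * σ u = 1 → D.eval u = 0 → (X - C u) ^ 2 ∣ D := by
    intro u hu hDu
    have hA := hconj u hu
    have hB := hconjB u hu
    have hH : ∀ v, v * σ v = 1 → (a * u ^ 2 + b * u + c) * v ^ 2 + (b * u ^ 2 + e * u + σ b) * v +
        (c * u ^ 2 + σ b * u + σ a) = 0 → u = v := fun v hv h0 =>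
      H u v hu hv (by linear_combination h0)
    have hnz := hnonzero u hu
    have hu0 : u ≠ 0 := left_ne_zero_of_mul_eq_one hu
    refine sq_dvd_of_isRoot_derivative hDu ?_
    rw [heval] at hDu
    have hder : (derivative D).eval u = 2 * (b * u ^ 2 + e * u + σ b) * (2 * b * u + e) -
        4 * ((2 * a * u + b) * (c * u ^ 2 + σ b * u + σ a) +
          (a * u ^ 2 + b * u + c) * (2 * c * u + σ b)) := by
      rw [hD]
      simp [derivative_pow]
      ring
    rw [hder]
    have hder0 : 2 * u * (a * u ^ 2 + b * u + c) + (b * u ^ 2 + e * u + σ b) =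
      2 * a * u ^ 3 + 3 * b * u ^ 2 + (e + 2 * c) * u + σ b := by ring
    obtain ⟨A, hAd⟩ : ∃ A, A = a * u ^ 2 + b * u + c := ⟨_, rfl⟩
    obtain ⟨B, hBd⟩ : ∃ B, B = b * u ^ 2 + e * u + σ b := ⟨_, rfl⟩
    obtain ⟨E, hEd⟩ : ∃ E, E = c * u ^ 2 + σ b * u + σ a := ⟨_, rfl⟩
    simp only [← hAd, ← hBd, ← hEd] at hA hB hDu hH hnz hder0 ⊢
    have hA0 : A ≠ 0 := by
      intro hA0
      rw [hA0, map_zero, zero_mul] at hA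
      rw [← hA, hA0] at hDu
      refine hnz ⟨hA0, ?_, hA.symm⟩
      have : B ^ 2 = 0 := by linear_combination hDu
      simpa using this
    have hE0 : E ≠ 0 := by
      rw [← hA]
      exact mul_ne_zero ((map_ne_zero σ).2 hA0) (pow_ne_zero 2 hu0)
    have hv := hH (-B / (2 * A)) ?_ ?_
    · have hBu : B = -2 * u * A := by
        rw [eq_div_iff (mul_ne_zero h2 hA0)] at hv
        linear_combination hv
      have hEu : E = u ^ 2 * A := by
        have : 4 * A * (E - u ^ 2 * A) = 0 := by
          rw [hBu] at hDu
          linear_combination -hDu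
        have h4 : (4 : F) ≠ 0 := by
          have := mul_ne_zero h2 h2
          norm_num at this
          exact this
        exact sub_eq_zero.1 ((mul_eq_zero.1 this).resolve_left (mul_ne_zero h4 hA0))
      rw [hEu, hBu]
      linear_combination 4 * A * hder0 - 4 * A * hBu
    · have hσA : σ A = E / u ^ 2 := by rw [← hA, mul_div_cancel_right₀ _ (pow_ne_zero 2 hu0)]
      have hσB : σ B = B / u ^ 2 := by
        rw [eq_div_iff (pow_ne_zero 2 hu0), hB]
      rw [map_div₀, map_neg, map_mul, hσA, hσB, map_ofNat]
      field_simp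
      linear_combination hDu
    · field_simp
      linear_combination -hDu
  have hfixed_pow : ∀ f, σ f = f → f ≠ 0 → f ^ (2 * m) = 1 := by
    intro f hf hf0
    rw [h.apply, pow_succ] at hf
    exact mul_right_cancel₀ hf0 (hf.trans (one_mul f).symm)
  have hval : ∀ u, u * σ u = 1 → D.eval u ≠ 0 → u ^ 2 * D.eval u ^ m = 1 := by
    intro u hu hDu
    have hA := hconj u hu
    have hB := hconjB u hu
    have hH : ∀ v, v * σ v = 1 → (a * u ^ 2 + b * u + c) * v ^ 2 + (b * u ^ 2 + e * u + σ b) * v +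
        (c * u ^ 2 + σ b * u + σ a) = 0 → u = v := fun v hv h0 =>
      H u v hu hv (by linear_combination h0)
    have hu0 : u ≠ 0 := left_ne_zero_of_mul_eq_one hu
    have hσu0 : σ u ≠ 0 := right_ne_zero_of_mul_eq_one hu
    have hf := hfix u hu
    have hf0 : D.eval u * σ u ^ 2 ≠ 0 := mul_ne_zero hDu (pow_ne_zero 2 hσu0)
    have hpow : (D.eval u * σ u ^ 2) ^ m = u ^ 2 * D.eval u ^ m := by
      have h1 : u * u ^ (2 * m + 1) = 1 := by rw [← h.apply, hu]
      have h3 : σ u * σ u ^ (2 * m + 1) = 1 := by rw [← h.apply, h.involutive, mul_comm, hu]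
      have h4 : σ u ^ (2 * m) = u ^ 2 := by
        apply mul_left_cancel₀ (pow_ne_zero 2 hσu0)
        rw [← mul_pow, mul_comm (σ u) u, hu, ← pow_add, one_pow, ← h3]
        ring
      rw [mul_pow, ← pow_mul, h4, mul_comm]
    rw [← hpow]
    have h1 := hfixed_pow _ hf hf0
    obtain ⟨t, ht⟩ := h.isSquare_of_fixed _ hf
    have ht0 : t ≠ 0 := by
      rintro rfl
      exact hf0 (by rw [ht]; simp)
    rw [mul_comm 2 m, pow_mul] at h1
    refine (mul_self_eq_one_iff.1 ((sq _).symm.trans h1)).resolve_right ?_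
    intro hneg
    have hσt : σ t = -t := by
      rw [h.apply, pow_succ, pow_mul, ← ht, hneg]
      ring
    have hs2 : (u * t) ^ 2 = D.eval u := by
      rw [mul_pow, ← ht]
      linear_combination D.eval u * (u * σ u + 1) * hu
    have hDe := heval u
    rw [heval] at hs2
    obtain ⟨A, hAd⟩ : ∃ A, A = a * u ^ 2 + b * u + c := ⟨_, rfl⟩
    obtain ⟨B, hBd⟩ : ∃ B, B = b * u ^ 2 + e * u + σ b := ⟨_, rfl⟩
    obtain ⟨E, hEd⟩ : ∃ E, E = c * u ^ 2 + σ b * u + σ a := ⟨_, rfl⟩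
    simp only [← hAd, ← hBd, ← hEd] at hA hB hH hs2 hDe
    rw [hDe] at hneg
    have hneg1 : (-1 : F) ≠ 1 := by
      intro h0
      exact h2 (by linear_combination -h0)
    have hA0 : A ≠ 0 := by
      intro hA0
      rw [hA0] at hneg hs2
      have hB' : σ (B * σ u) = B * σ u := by
        rw [map_mul, h.involutive]
        linear_combination σ u * hB - σ B * u * hu
      have hB0 : B * σ u ≠ 0 := by
        refine mul_ne_zero ?_ hσu0
        rintro rfl
        rw [mul_zero, zero_mul, sub_eq_zero.2 (by ring)] at hs2
        exact mul_ne_zero hu0 ht0 (pow_eq_zero_iff (n := 2) (by norm_num) |>.1 hs2)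
      have := hfixed_pow _ hB' hB0
      rw [pow_mul] at this
      apply hneg1
      rw [← hneg, ← this]
      ring
    have hE0 : E ≠ 0 := by
      rw [← hA]
      exact mul_ne_zero ((map_ne_zero σ).2 hA0) (pow_ne_zero 2 hu0)
    have hσA : σ A = E / u ^ 2 := by rw [← hA, mul_div_cancel_right₀ _ (pow_ne_zero 2 hu0)]
    have hσB : σ B = B / u ^ 2 := by
      rw [eq_div_iff (pow_ne_zero 2 hu0), hB]
    have key : ∀ s, s ^ 2 = (u * t) ^ 2 → σ s = -s / u ^ 2 → u = (-B + s) / (2 * A) := by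
      intro s hs hσs
      rw [hs2] at hs
      refine hH _ ?_ ?_
      · rw [map_div₀, map_add, map_neg, map_mul, hσA, hσB, hσs, map_ofNat]
        field_simp
        linear_combination -hs
      · field_simp
        linear_combination hs
    have hσs : σ (u * t) = -(u * t) / u ^ 2 := by
      rw [map_mul, hσt, eq_div_iff (pow_ne_zero 2 hu0)]
      linear_combination -u * t * hu
    have k1 := key (u * t) rfl hσs
    have k2 := key (-(u * t)) (by ring) (by rw [map_neg, hσs]; ring)
    have k3 := k1.symm.trans k2
    rw [div_left_inj' (mul_ne_zero h2 hA0)] at k3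
    exact mul_ne_zero h2 (mul_ne_zero hu0 ht0) (by linear_combination k3)
  obtain ⟨κ, M, hM, hDM⟩ := h.exists_eq_C_mul_sq hDdeg hsq hval
  rw [← hD]
  by_cases hM0 : M = 0
  · exact ⟨0, by simp, by rw [hDM, hM0]; simp⟩
  obtain ⟨u, hu, hMu⟩ := h.exists_eval_ne_zero hM0 (by omega)
  obtain ⟨t, ht⟩ := h.isSquare_of_fixed _ (hfix u hu)
  refine ⟨C (t * u / M.eval u) * M, (natDegree_C_mul_le _ _).trans hM, ?_⟩
  have hκ : κ = (t * u / M.eval u) ^ 2 := by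
    rw [div_pow, mul_pow, ← ht, hDM, eq_div_iff (pow_ne_zero 2 hMu)]
    simp only [eval_mul, eval_C, eval_pow]
    linear_combination -κ * eval u M ^ 2 * (u * σ u + 1) * hu
  rw [hDM, mul_pow, ← C_pow, ← hκ]

end IsQuadraticFrobenius

/-- The discriminant, with respect to one variable, of the antisymmetrisation of two binary cubic
forms, in coordinates `(ξ, η)` in which one of them is diagonal. -/
theorem discrim_add_three_mul_sq {R : Type*} [CommRing R] (α β γ δ κ w A B C E x : R)
    {p₀ p₁ p₂ p₃ r₀ r₁ r₂ r₃ : R}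
    (hp₃ : p₃ = κ * (α ^ 3 - w * γ ^ 3)) (hp₂ : p₂ = 3 * κ * (α ^ 2 * β - w * γ ^ 2 * δ))
    (hp₁ : p₁ = 3 * κ * (α * β ^ 2 - w * γ * δ ^ 2)) (hp₀ : p₀ = κ * (β ^ 3 - w * δ ^ 3))
    (hr₃ : r₃ = A * (α ^ 3 - w * γ ^ 3) + B * α ^ 2 * γ + C * α * γ ^ 2 + E * γ ^ 3)
    (hr₂ : r₂ = 3 * A * (α ^ 2 * β - w * γ ^ 2 * δ) + B * (α ^ 2 * δ + 2 * α * β * γ) +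
      C * (β * γ ^ 2 + 2 * α * γ * δ) + 3 * E * γ ^ 2 * δ)
    (hr₁ : r₁ = 3 * A * (α * β ^ 2 - w * γ * δ ^ 2) + B * (2 * α * β * δ + β ^ 2 * γ) +
      C * (α * δ ^ 2 + 2 * β * γ * δ) + 3 * E * γ * δ ^ 2)
    (hr₀ : r₀ = A * (β ^ 3 - w * δ ^ 3) + B * β ^ 2 * δ + C * β * δ ^ 2 + E * δ ^ 3) :
    ((r₃ * p₁ - p₃ * r₁) * x ^ 2 + (r₃ * p₀ - p₃ * r₀ + (r₂ * p₁ - p₂ * r₁)) * x +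
        (r₂ * p₀ - p₂ * r₀)) ^ 2 -
      4 * ((r₃ * p₂ - p₃ * r₂) * x ^ 2 + (r₃ * p₁ - p₃ * r₁) * x + (r₃ * p₀ - p₃ * r₀)) *
        ((r₃ * p₀ - p₃ * r₀) * x ^ 2 + (r₂ * p₀ - p₂ * r₀) * x + (r₁ * p₀ - p₁ * r₀)) +
      3 * (κ * (α * δ - β * γ) ^ 2 * (C * (α * x + β) ^ 2 + E * (α * x + β) * (γ * x + δ) +
        w * B * (γ * x + δ) ^ 2)) ^ 2 =
    4 * (κ * (α * δ - β * γ) ^ 2) ^ 2 * ((α * x + β) ^ 3 - w * (γ * x + δ) ^ 3) *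
      ((C ^ 2 - B * E) * (α * x + β) + (C * E - w * B ^ 2) * (γ * x + δ)) := by
  obtain ⟨ξ, hξ⟩ : ∃ ξ, ξ = α * x + β := ⟨_, rfl⟩
  obtain ⟨η, hη⟩ : ∃ η, η = γ * x + δ := ⟨_, rfl⟩
  obtain ⟨A', hA'⟩ : ∃ A', A' = B * ξ ^ 2 + C * ξ * η + E * η ^ 2 := ⟨_, rfl⟩
  obtain ⟨N, hN⟩ : ∃ N, N = C * ξ ^ 2 + E * ξ * η + w * B * η ^ 2 := ⟨_, rfl⟩
  obtain ⟨E', hE'⟩ : ∃ E', E' = E * ξ ^ 2 + w * B * ξ * η + w * C * η ^ 2 := ⟨_, rfl⟩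
  have h1 : (r₃ * p₂ - p₃ * r₂) * x ^ 2 + (r₃ * p₁ - p₃ * r₁) * x + (r₃ * p₀ - p₃ * r₀) =
      -κ * (α * δ - β * γ) * (α ^ 2 * A' + α * γ * N + γ ^ 2 * E') := by
    subst hp₀ hp₁ hp₂ hp₃ hr₀ hr₁ hr₂ hr₃ hA' hN hE' hξ hη
    ring
  have h2 : (r₃ * p₁ - p₃ * r₁) * x ^ 2 + (r₃ * p₀ - p₃ * r₀ + (r₂ * p₁ - p₂ * r₁)) * x +
        (r₂ * p₀ - p₂ * r₀) = -κ * (α * δ - β * γ) *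
        (2 * α * β * A' + (α * δ + β * γ) * N + 2 * γ * δ * E') := by
    subst hp₀ hp₁ hp₂ hp₃ hr₀ hr₁ hr₂ hr₃ hA' hN hE' hξ hη
    ring
  have h3 : (r₃ * p₀ - p₃ * r₀) * x ^ 2 + (r₂ * p₀ - p₂ * r₀) * x + (r₁ * p₀ - p₁ * r₀) =
      -κ * (α * δ - β * γ) * (β ^ 2 * A' + β * δ * N + δ ^ 2 * E') := by
    subst hp₀ hp₁ hp₂ hp₃ hr₀ hr₁ hr₂ hr₃ hA' hN hE' hξ hη
    ring
  rw [h1, h2, h3, ← hξ, ← hη, hA', hN, hE']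
  ring

namespace IsQuadraticFrobenius

variable {F : Type*} [Field F] {p m : ℕ} {σ : F →+* F}

theorem apply_eq_pow_mul (h : IsQuadraticFrobenius p m σ) (x : F) : σ x = x ^ (2 * m) * x := by
  rw [h.apply, pow_succ]

theorem condition1_iff (h : IsQuadraticFrobenius p m σ) {P : F[X]} :
    Condition1 (2 * m + 1) 3 P ↔ ∀ x y : F, x ≠ 0 → y ≠ 0 →
      x ^ 3 * P.eval (x ^ (2 * m)) * σ (y ^ 3 * P.eval (y ^ (2 * m))) =
        σ (x ^ 3 * P.eval (x ^ (2 * m))) * (y ^ 3 * P.eval (y ^ (2 * m))) →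
      x * σ y = σ x * y := by
  simp only [Condition1, h.apply, Nat.add_sub_cancel]

theorem exists_apply_ne (h : IsQuadraticFrobenius p m σ) : ∃ c, σ c ≠ c := by
  obtain ⟨ζ, hζ⟩ := h.exists_primitive
  have := h.two_le
  refine ⟨ζ, fun hc => hζ.pow_ne_one_of_pos_of_lt (l := 2) (by omega) (by omega) ?_⟩
  rw [sq]
  nth_rw 2 [← hc]
  exact h.mul_apply_eq_one_iff.2 hζ.pow_eq_one

theorem exists_apply_eq_mul (h : IsQuadraticFrobenius p m σ) {u : F} (hu : u * σ u = 1) :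
    ∃ y, y ≠ 0 ∧ σ y = u * y := by
  by_cases h1 : 1 + σ u = 0
  · obtain ⟨c, hc⟩ := h.exists_apply_ne
    have hu1 : u = -1 := by
      rw [← h.involutive u, eq_neg_of_add_eq_zero_right h1, map_neg, map_one]
    exact ⟨σ c - c, sub_ne_zero.2 hc, by rw [map_sub, h.involutive, hu1]; ring⟩
  · exact ⟨1 + σ u, h1, by rw [map_add, map_one, h.involutive]; linear_combination -hu⟩

theorem exists_discrim_eq_sq_of_condition1 (h : IsQuadraticFrobenius p m σ) {P : F[X]}
    {p₀ p₁ p₂ p₃ : F} (hP : P = C p₃ * X ^ 3 + C p₂ * X ^ 2 + C p₁ * X + C p₀)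
    (hcond : Condition1 (2 * m + 1) 3 P) {r₀ r₁ r₂ r₃ : F[X]} (hr₀ : r₀ = C (σ p₃))
    (hr₁ : r₁ = C (σ p₂)) (hr₂ : r₂ = C (σ p₁)) (hr₃ : r₃ = C (σ p₀)) :
    ∃ M : F[X], M.natDegree ≤ 2 ∧
      ((r₃ * C p₁ - C p₃ * r₁) * X ^ 2 + (r₃ * C p₀ - C p₃ * r₀ + (r₂ * C p₁ - C p₂ * r₁)) * X +
        (r₂ * C p₀ - C p₂ * r₀)) ^ 2 -
      4 * ((r₃ * C p₂ - C p₃ * r₂) * X ^ 2 + (r₃ * C p₁ - C p₃ * r₁) * X +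
          (r₃ * C p₀ - C p₃ * r₀)) *
        ((r₃ * C p₀ - C p₃ * r₀) * X ^ 2 + (r₂ * C p₀ - C p₂ * r₀) * X +
          (r₁ * C p₀ - C p₁ * r₀)) = M ^ 2 := by
  rw [h.condition1_iff] at hcond
  have heval : ∀ x, P.eval x = p₃ * x ^ 3 + p₂ * x ^ 2 + p₁ * x + p₀ := by
    intro x
    rw [hP]
    simp
  have hsq := h.exists_discrim_eq_sq (σ p₀ * p₂ - p₃ * σ p₁) (σ p₀ * p₁ - p₃ * σ p₂)
    (σ p₀ * p₀ - p₃ * σ p₃) (σ p₀ * p₀ - p₃ * σ p₃ + (σ p₁ * p₁ - p₂ * σ p₂)) ?_ ?_ ?_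
  · obtain ⟨M, hM, hDM⟩ := hsq
    refine ⟨M, hM, ?_⟩
    rw [← hDM, hr₀, hr₁, hr₂, hr₃]
    simp only [map_sub, map_add, map_mul, h.involutive]
    ring
  · simp only [map_sub, map_mul, h.involutive]
    ring
  · simp only [map_sub, map_add, map_mul, h.involutive]
    ring
  · intro u v hu hv hG
    obtain ⟨x, hx0, hx⟩ := h.exists_apply_eq_mul hu
    obtain ⟨y, hy0, hy⟩ := h.exists_apply_eq_mul hv
    have hval : ∀ x u, x ≠ 0 → σ x = u * x → x ^ (2 * m) = u := fun x u hx0 hx =>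
      mul_right_cancel₀ hx0 ((h.apply_eq_pow_mul x).symm.trans hx)
    have hf : ∀ x u, u * σ u = 1 → σ x = u * x → σ (x ^ 3 * P.eval u) =
        x ^ 3 * (σ p₀ * u ^ 3 + σ p₁ * u ^ 2 + σ p₂ * u + σ p₃) := by
      intro x u hu hx
      rw [heval]
      simp only [map_mul, map_add, map_pow, hx]
      linear_combination x ^ 3 * (σ p₃ * (1 + u * σ u + (u * σ u) ^ 2) +
        σ p₂ * u * (1 + u * σ u) + σ p₁ * u ^ 2) * hu
    have key := hcond x y hx0 hy0 ?_
    · rw [hx, hy] at key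
      exact (mul_right_cancel₀ (mul_ne_zero hx0 hy0) (by linear_combination key)).symm
    · rw [hval x u hx0 hx, hval y v hy0 hy, hf x u hu hx, hf y v hv hy, heval, heval]
      simp only [map_sub, map_mul, h.involutive] at hG
      linear_combination x ^ 3 * y ^ 3 * (v - u) * hG

theorem exists_sq_eq_neg_three (h : IsQuadraticFrobenius p m σ) : ∃ τ : F, τ ^ 2 = -3 := by
  obtain ⟨τ, hτ⟩ := h.isSquare_of_fixed (-3) (by rw [map_neg, map_ofNat])
  exact ⟨τ, hτ.symm⟩

/-- If an irreducible cubic `κ (ξ³ - w η³)` satisfies Condition (1), then the conjugate-reversal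
of linear forms either fixes or exchanges the lines spanned by `ξ` and `η`. -/
theorem conjReverse_diag_or_antidiag (h : IsQuadraticFrobenius p m σ) {P : F[X]}
    {α β γ δ κ w a b c d : F} (hκ : κ ≠ 0) (hΔ : α * δ - β * γ ≠ 0) (hw : ∀ z, z ^ 3 ≠ w)
    (hP : P = C κ * ((C α * X + C β) ^ 3 - C w * (C γ * X + C δ) ^ 3)) (hirr : Irreducible P)
    (hdeg : P.natDegree = 3) (hcond : Condition1 (2 * m + 1) 3 P)
    (hβ : σ β = a * α + b * γ) (hα : σ α = a * β + b * δ)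
    (hδ : σ δ = c * α + d * γ) (hγ : σ γ = c * β + d * δ) :
    b = 0 ∧ c = 0 ∨ a = 0 ∧ d = 0 := by
  have h3 := h.three_ne_zero
  have hw0 : w ≠ 0 := fun h0 => hw 0 (by rw [h0]; ring)
  have hσw0 : σ w ≠ 0 := (map_ne_zero σ).2 hw0
  have hσκ : σ κ ≠ 0 := (map_ne_zero σ).2 hκ
  obtain ⟨A, hA⟩ : ∃ A, A = σ κ * (a ^ 3 - σ w * c ^ 3) := ⟨_, rfl⟩
  obtain ⟨B, hB⟩ : ∃ B, B = 3 * σ κ * (a ^ 2 * b - σ w * c ^ 2 * d) := ⟨_, rfl⟩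
  obtain ⟨G, hG⟩ : ∃ G, G = 3 * σ κ * (a * b ^ 2 - σ w * c * d ^ 2) := ⟨_, rfl⟩
  obtain ⟨E, hE⟩ : ∃ E, E = σ κ * (b ^ 3 - σ w * d ^ 3) + w * A := ⟨_, rfl⟩
  obtain ⟨M, hM, hDM⟩ := h.exists_discrim_eq_sq_of_condition1
    (p₃ := κ * (α ^ 3 - w * γ ^ 3)) (p₂ := 3 * κ * (α ^ 2 * β - w * γ ^ 2 * δ))
    (p₁ := 3 * κ * (α * β ^ 2 - w * γ * δ ^ 2)) (p₀ := κ * (β ^ 3 - w * δ ^ 3))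
    (by rw [hP]; simp only [C_mul, C_sub, C_pow, map_ofNat]; ring) hcond rfl rfl rfl rfl
  have hid := discrim_add_three_mul_sq (R := F[X]) (C α) (C β) (C γ) (C δ) (C κ) (C w) (C A) (C B)
    (C G) (C E) X (p₃ := C (κ * (α ^ 3 - w * γ ^ 3)))
    (p₂ := C (3 * κ * (α ^ 2 * β - w * γ ^ 2 * δ)))
    (p₁ := C (3 * κ * (α * β ^ 2 - w * γ * δ ^ 2))) (p₀ := C (κ * (β ^ 3 - w * δ ^ 3)))
    (r₃ := C (σ (κ * (β ^ 3 - w * δ ^ 3)))) (r₂ := C (σ (3 * κ * (α * β ^ 2 - w * γ * δ ^ 2))))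
    (r₁ := C (σ (3 * κ * (α ^ 2 * β - w * γ ^ 2 * δ)))) (r₀ := C (σ (κ * (α ^ 3 - w * γ ^ 3))))
    (by simp only [C_mul, C_sub, C_pow]) (by simp only [C_mul, C_sub, C_pow, map_ofNat])
    (by simp only [C_mul, C_sub, C_pow, map_ofNat]) (by simp only [C_mul, C_sub, C_pow]) ?_ ?_ ?_ ?_
  rotate_left
  · rw [hE, hA, hB, hG]
    simp only [map_mul, map_sub, map_pow, map_add, hβ, hδ, map_ofNat]
    ring
  · rw [hE, hA, hB, hG]
    simp only [map_mul, map_sub, map_pow, map_add, hα, hβ, hγ, hδ, map_ofNat]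
    ring
  · rw [hE, hA, hB, hG]
    simp only [map_mul, map_sub, map_pow, map_add, hα, hβ, hγ, hδ, map_ofNat]
    ring
  · rw [hE, hA, hB, hG]
    simp only [map_mul, map_sub, map_pow, map_add, hα, hγ, map_ofNat]
    ring
  rw [hDM] at hid
  obtain ⟨N, hN⟩ : ∃ N, N = C κ * (C α * C δ - C β * C γ) ^ 2 *
    (C G * (C α * X + C β) ^ 2 + C E * (C α * X + C β) * (C γ * X + C δ) +
      C w * C B * (C γ * X + C δ) ^ 2) := ⟨_, rfl⟩
  rw [← hN] at hid
  have hNdeg : N.natDegree ≤ 2 := by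
    rw [hN]
    compute_degree
  obtain ⟨L, hL⟩ : ∃ L, L = (C G ^ 2 - C B * C E) * (C α * X + C β) +
    (C G * C E - C w * C B ^ 2) * (C γ * X + C δ) := ⟨_, rfl⟩
  rw [← hL] at hid
  obtain ⟨τ, hτ⟩ := h.exists_sq_eq_neg_three
  have hCτ : (C τ : F[X]) ^ 2 = -3 := by rw [← C_pow, hτ, C_neg, map_ofNat]
  have hκΔ : C κ * (C α * C δ - C β * C γ) ^ 4 ≠ 0 := by
    rw [← C_mul, ← C_mul, ← C_sub, ← C_pow, ← C_mul]
    exact C_ne_zero.2 (mul_ne_zero hκ (pow_ne_zero 4 hΔ))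
  have hprod : (M - C τ * N) * (M + C τ * N) =
      P * (4 * (C κ * (C α * C δ - C β * C γ) ^ 4) * L) := by
    rw [hP]
    linear_combination hid - N ^ 2 * hCτ
  have hzero : (M - C τ * N) * (M + C τ * N) = 0 := by
    have hCN : (C τ * N).natDegree ≤ 2 := (natDegree_C_mul_le _ _).trans hNdeg
    rcases hirr.prime.dvd_or_dvd ⟨_, hprod⟩ with hd | hd
    · rw [eq_zero_of_dvd_of_natDegree_lt hd, zero_mul]
      have := natDegree_sub_le_of_le hM hCN
      omega
    · rw [eq_zero_of_dvd_of_natDegree_lt hd, mul_zero]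
      have := natDegree_add_le_of_degree_le hM hCN
      omega
  have hL0 : L = 0 := by
    rw [hzero] at hprod
    have h4 : (4 : F[X]) ≠ 0 := by
      have : (4 : F) ≠ 0 := by
        have := mul_ne_zero h.two_ne_zero h.two_ne_zero
        norm_num at this
        exact this
      rw [← map_ofNat C]
      exact C_ne_zero.2 this
    have := (mul_eq_zero.1 hprod.symm).resolve_left hirr.ne_zero
    exact (mul_eq_zero.1 this).resolve_left (mul_ne_zero h4 hκΔ)
  rw [hL] at hL0
  have hl1 : (G ^ 2 - B * E) * α + (G * E - w * B ^ 2) * γ = 0 := by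
    have := congrArg (fun f => f.eval 1 - f.eval 0) hL0
    simp at this
    linear_combination this
  have hl0 : (G ^ 2 - B * E) * β + (G * E - w * B ^ 2) * δ = 0 := by
    have := congrArg (eval 0) hL0
    simp at this
    linear_combination this
  have hGB : G ^ 2 - B * E = 0 := by
    refine (mul_eq_zero.1 ?_).resolve_right hΔ
    linear_combination δ * hl1 - γ * hl0
  have hGE : G * E - w * B ^ 2 = 0 := by
    refine (mul_eq_zero.1 ?_).resolve_right hΔ
    linear_combination α * hl0 - β * hl1
  have hB0 : B = 0 := by
    by_contra hB0
    refine hw (G / B) ?_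
    rw [div_pow, div_eq_iff (pow_ne_zero 3 hB0)]
    linear_combination G * hGB + B * hGE
  have hG0 : G = 0 := by
    rw [hB0] at hGB
    exact pow_eq_zero_iff (n := 2) (by norm_num) |>.1 (by linear_combination hGB)
  have hdet : a * d - b * c ≠ 0 := by
    intro h0
    refine (map_ne_zero σ).2 hΔ ?_
    simp only [map_sub, map_mul, hα, hβ, hγ, hδ]
    linear_combination (β * γ - α * δ) * h0
  have e1 : a ^ 2 * b = σ w * c ^ 2 * d := by
    rw [hB] at hB0
    exact sub_eq_zero.1 ((mul_eq_zero.1 hB0).resolve_left (mul_ne_zero h3 hσκ))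
  have e2 : a * b ^ 2 = σ w * c * d ^ 2 := by
    rw [hG] at hG0
    exact sub_eq_zero.1 ((mul_eq_zero.1 hG0).resolve_left (mul_ne_zero h3 hσκ))
  have e3 : a * b * (c * d) = 0 := by
    have : σ w * (a * d - b * c) * (a * b * (c * d)) = 0 := by
      linear_combination σ w * c * d ^ 2 * e1 - σ w * c ^ 2 * d * e2
    exact (mul_eq_zero.1 this).resolve_left (mul_ne_zero hσw0 hdet)
  have hab : a * b = 0 := by
    rcases mul_eq_zero.1 e3 with h0 | h0
    · exact h0
    · refine pow_eq_zero_iff (n := 3) (by norm_num) |>.1 ?_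
      linear_combination a * b ^ 2 * e1 + σ w * c * a * b ^ 2 * h0
  have hcd : c * d = 0 := by
    have : σ w * (c * d) ^ 3 = 0 := by
      linear_combination -c * d ^ 2 * e1 + a * c * d ^ 2 * hab
    exact pow_eq_zero_iff (n := 3) (by norm_num) |>.1 ((mul_eq_zero.1 this).resolve_left hσw0)
  rcases mul_eq_zero.1 hab with ha | hb
  · right
    refine ⟨ha, (mul_eq_zero.1 hcd).resolve_left ?_⟩
    rintro rfl
    exact hdet (by rw [ha]; ring)
  · left
    refine ⟨hb, (mul_eq_zero.1 hcd).resolve_right ?_⟩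
    rintro rfl
    exact hdet (by rw [hb]; ring)

end IsQuadraticFrobenius

/-- The monic cubic whose Hessian form has the zeros `a` and `b`. -/
def splitHessianCubic {F : Type*} [Field F] (a b w : F) : F[X] :=
  C (1 - w)⁻¹ * ((X - C a) ^ 3 - C w * (X - C b) ^ 3)

theorem pow_three_mul_eval_splitHessianCubic {F : Type*} [Field F] (a b w x u : F) :
    x ^ 3 * (splitHessianCubic a b w).eval u =
      (1 - w)⁻¹ * ((u * x - a * x) ^ 3 - w * (u * x - b * x) ^ 3) := by
  simp only [splitHessianCubic, eval_mul, eval_C, eval_sub, eval_pow, eval_X]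
  ring

/-- An element one of whose powers with exponent prime to three is a cube is a cube. -/
theorem exists_cube_of_pow_eq_cube {F : Type*} [Field F] {w c : F} {k : ℕ} (hk : k % 3 ≠ 0)
    (h : w ^ k = c ^ 3) : ∃ z, z ^ 3 = w := by
  by_cases hw : w = 0
  · exact ⟨0, by rw [hw]; ring⟩
  have hc : c ≠ 0 := by
    rintro rfl
    exact pow_ne_zero k hw (by rw [h]; ring)
  obtain ⟨j, hj | hj⟩ : ∃ j, k = 3 * j + 1 ∨ k = 3 * j + 2 := ⟨k / 3, by omega⟩
  · refine ⟨c / w ^ j, ?_⟩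
    rw [div_pow, div_eq_iff (pow_ne_zero 3 (pow_ne_zero j hw)), ← h, hj]
    ring
  · refine ⟨w ^ (j + 1) / c, ?_⟩
    rw [div_pow, div_eq_iff (pow_ne_zero 3 hc), ← h, hj]
    ring

theorem eq_one_of_pow_three_eq_one {F : Type*} [Field F] {z : F} {k : ℕ} (hk : k % 3 ≠ 0)
    (h3 : z ^ 3 = 1) (h : z ^ k = 1) : z = 1 := by
  obtain ⟨j, hj | hj⟩ : ∃ j, k = 3 * j + 1 ∨ k = 3 * j + 2 := ⟨k / 3, by omega⟩
  · rw [hj, pow_add, pow_mul, h3] at h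
    simpa using h
  · rw [hj, pow_add, pow_mul, h3, one_pow, one_mul] at h
    linear_combination h3 - z * h

theorem eq_of_pow_three_eq_of_pow_eq {F : Type*} [Field F] {s t : F} {k : ℕ} (hk : k % 3 ≠ 0)
    (h3 : s ^ 3 = t ^ 3) (h : s ^ k = t ^ k) : s = t := by
  by_cases ht : t = 0
  · subst ht
    exact pow_eq_zero_iff (n := 3) (by norm_num) |>.1 (by rw [h3]; ring)
  · rw [← div_eq_one_iff_eq ht]
    refine eq_one_of_pow_three_eq_one hk ?_ ?_
    · rw [div_pow, h3, div_self (pow_ne_zero 3 ht)]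
    · rw [div_pow, h, div_self (pow_ne_zero k ht)]

namespace IsQuadraticFrobenius

variable {F : Type*} [Field F] {p m : ℕ} {σ : F →+* F}

/-- Proportionality modulo the fixed field forces proportionality of `(ξ, η)`, when conjugation
acts diagonally on `(ξ, η)`. -/
theorem mul_eq_mul_of_diag (h : IsQuadraticFrobenius p m σ) (hq : (2 * m + 1) % 3 = 2)
    {w κ α β : F} (hw : ∀ z, z ^ 3 ≠ w) (hκ : κ ≠ 0) (hβ : β ≠ 0)
    {ξ₁ η₁ ξ₂ η₂ : F} (h₁ : σ ξ₁ = α * ξ₁) (h₂ : σ η₁ = β * η₁) (h₃ : σ ξ₂ = α * ξ₂)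
    (h₄ : σ η₂ = β * η₂)
    (H : κ * (ξ₁ ^ 3 - w * η₁ ^ 3) * σ (κ * (ξ₂ ^ 3 - w * η₂ ^ 3)) =
      σ (κ * (ξ₁ ^ 3 - w * η₁ ^ 3)) * (κ * (ξ₂ ^ 3 - w * η₂ ^ 3))) :
    ξ₁ * η₂ = η₁ * ξ₂ := by
  have hσκ : σ κ ≠ 0 := (map_ne_zero σ).2 hκ
  have hw0 : w ≠ 0 := fun h0 => hw 0 (by rw [h0]; ring)
  have hdet : w * α ^ 3 - σ w * β ^ 3 ≠ 0 := by
    intro h0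
    have : w ^ (2 * m) = (α / β) ^ 3 := by
      rw [div_pow, eq_div_iff (pow_ne_zero 3 hβ)]
      apply mul_left_cancel₀ hw0
      rw [← mul_assoc, mul_comm w, ← h.apply_eq_pow_mul]
      linear_combination -h0
    obtain ⟨z, hz⟩ := exists_cube_of_pow_eq_cube (by omega) this
    exact hw z hz
  have h3 : (ξ₁ * η₂) ^ 3 = (η₁ * ξ₂) ^ 3 := by
    simp only [map_mul, map_sub, map_pow, h₁, h₂, h₃, h₄] at H
    rw [← sub_eq_zero]
    refine (mul_eq_zero.1 ?_).resolve_left (mul_ne_zero (mul_ne_zero hκ hσκ) hdet)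
    linear_combination H
  by_cases ht : η₁ * ξ₂ = 0
  · rw [ht] at h3 ⊢
    exact pow_eq_zero_iff (n := 3) (by norm_num) |>.1 (by rw [h3]; ring)
  have hs : ξ₁ * η₂ ≠ 0 := by
    intro hs
    rw [hs] at h3
    exact ht (pow_eq_zero_iff (n := 3) (by norm_num) |>.1 (by rw [← h3]; ring))
  refine eq_of_pow_three_eq_of_pow_eq (k := 2 * m) (by omega) h3 ?_
  have e1 : (ξ₁ * η₂) ^ (2 * m) = α * β := by
    apply mul_right_cancel₀ hs
    rw [← h.apply_eq_pow_mul, map_mul, h₁, h₄]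
    ring
  have e2 : (η₁ * ξ₂) ^ (2 * m) = α * β := by
    apply mul_right_cancel₀ ht
    rw [← h.apply_eq_pow_mul, map_mul, h₂, h₃]
    ring
  rw [e1, e2]

/-- Proportionality modulo the fixed field forces proportionality of `(ξ, η)`, when conjugation
acts antidiagonally on `(ξ, η)`. -/
theorem mul_eq_mul_of_antidiag (h : IsQuadraticFrobenius p m σ) (hq : (2 * m + 1) % 3 = 1)
    {w κ α β : F} (hw : ∀ z, z ^ 3 ≠ w) (hκ : κ ≠ 0) (hβ : β ≠ 0)
    {ξ₁ η₁ ξ₂ η₂ : F} (h₁ : σ ξ₁ = α * η₁) (h₂ : σ η₁ = β * ξ₁) (h₃ : σ ξ₂ = α * η₂)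
    (h₄ : σ η₂ = β * ξ₂)
    (H : κ * (ξ₁ ^ 3 - w * η₁ ^ 3) * σ (κ * (ξ₂ ^ 3 - w * η₂ ^ 3)) =
      σ (κ * (ξ₁ ^ 3 - w * η₁ ^ 3)) * (κ * (ξ₂ ^ 3 - w * η₂ ^ 3))) :
    ξ₁ * η₂ = η₁ * ξ₂ := by
  have hσκ : σ κ ≠ 0 := (map_ne_zero σ).2 hκ
  have hdet : α ^ 3 - w * σ w * β ^ 3 ≠ 0 := by
    intro h0
    have : w ^ (2 * m + 2) = (α / β) ^ 3 := by
      rw [div_pow, eq_div_iff (pow_ne_zero 3 hβ), pow_succ' w, ← h.apply]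
      linear_combination -h0
    obtain ⟨z, hz⟩ := exists_cube_of_pow_eq_cube (by omega) this
    exact hw z hz
  have h3 : (ξ₁ * η₂) ^ 3 = (η₁ * ξ₂) ^ 3 := by
    simp only [map_mul, map_sub, map_pow, h₁, h₂, h₃, h₄] at H
    rw [← sub_eq_zero]
    refine (mul_eq_zero.1 ?_).resolve_left (mul_ne_zero (mul_ne_zero hκ hσκ) hdet)
    linear_combination H
  refine eq_of_pow_three_eq_of_pow_eq (k := 2 * m + 2) (by omega) h3 ?_
  rw [pow_succ (ξ₁ * η₂), ← h.apply, pow_succ (η₁ * ξ₂), ← h.apply, map_mul, map_mul, h₁, h₂, h₃,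
    h₄]
  ring

theorem condition1_splitHessianCubic_of_diag (h : IsQuadraticFrobenius p m σ)
    (hq : (2 * m + 1) % 3 = 2) {a b w : F} (hw : ∀ z, z ^ 3 ≠ w) (hab : a ≠ b) (ha : a * σ a = 1)
    (hb : b * σ b = 1) : Condition1 (2 * m + 1) 3 (splitHessianCubic a b w) := by
  rw [h.condition1_iff]
  intro x y _ _ H
  have hw1 : (1 - w)⁻¹ ≠ 0 := inv_ne_zero (sub_ne_zero.2 fun h1 => hw 1 (by rw [← h1]; ring))
  simp only [pow_three_mul_eval_splitHessianCubic, ← h.apply_eq_pow_mul] at H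
  have key : ∀ a x, a * σ a = 1 → σ (σ x - a * x) = -σ a * (σ x - a * x) := by
    intro a x ha
    rw [map_sub, map_mul, h.involutive]
    linear_combination -x * ha
  have := h.mul_eq_mul_of_diag hq hw hw1
    (neg_ne_zero.2 (right_ne_zero_of_mul_eq_one hb)) (key a x ha) (key b x hb) (key a y ha)
    (key b y hb) H
  apply mul_left_cancel₀ (sub_ne_zero.2 hab)
  linear_combination -this

theorem condition1_splitHessianCubic_of_antidiag (h : IsQuadraticFrobenius p m σ)
    (hq : (2 * m + 1) % 3 = 1) {a b w : F} (hw : ∀ z, z ^ 3 ≠ w) (hab : a ≠ b) (ha : b * σ a = 1) :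
    Condition1 (2 * m + 1) 3 (splitHessianCubic a b w) := by
  rw [h.condition1_iff]
  intro x y _ _ H
  have hw1 : (1 - w)⁻¹ ≠ 0 := inv_ne_zero (sub_ne_zero.2 fun h1 => hw 1 (by rw [← h1]; ring))
  simp only [pow_three_mul_eval_splitHessianCubic, ← h.apply_eq_pow_mul] at H
  have hb : a * σ b = 1 := by
    rw [← h.involutive a, ← map_mul, mul_comm, ha, map_one]
  have key : ∀ a b x, b * σ a = 1 → σ (σ x - a * x) = -σ a * (σ x - b * x) := by
    intro a b x ha
    rw [map_sub, map_mul, h.involutive]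
    linear_combination -x * ha
  have := h.mul_eq_mul_of_antidiag hq hw hw1
    (neg_ne_zero.2 (right_ne_zero_of_mul_eq_one hb)) (key a b x ha) (key b a x hb) (key a b y ha)
    (key b a y hb) H
  apply mul_left_cancel₀ (sub_ne_zero.2 hab)
  linear_combination -this

theorem condition1_X_pow_three_sub_C (h : IsQuadraticFrobenius p m σ)
    (hq : (2 * m + 1) % 3 = 1) {w : F} (hw : ∀ z, z ^ 3 ≠ w) :
    Condition1 (2 * m + 1) 3 (X ^ 3 - C w : F[X]) := by
  rw [h.condition1_iff]
  intro x y _ _ H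
  have hf : ∀ x, x ^ 3 * (X ^ 3 - C w : F[X]).eval (x ^ (2 * m)) =
      1 * (σ x ^ 3 - w * x ^ 3) := by
    intro x
    rw [h.apply_eq_pow_mul]
    simp
    ring
  simp only [hf] at H
  have key : ∀ x, σ (σ x) = 1 * x ∧ σ x = 1 * σ x := fun x =>
    ⟨by rw [h.involutive, one_mul], (one_mul _).symm⟩
  exact (h.mul_eq_mul_of_antidiag hq hw one_ne_zero one_ne_zero (key x).1 (key x).2 (key y).1
    (key y).2 H).symm

/-- A primitive cube root of unity. -/
theorem exists_cube_root (h : IsQuadraticFrobenius p m σ) : ∃ ω : F, ω ^ 2 + ω + 1 = 0 := by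
  obtain ⟨τ, hτ⟩ := h.exists_sq_eq_neg_three
  have h2 := h.two_ne_zero
  refine ⟨(-1 + τ) / 2, ?_⟩
  field_simp
  linear_combination hτ

theorem apply_cube_root_of_mod_eq_one (h : IsQuadraticFrobenius p m σ)
    (hq : (2 * m + 1) % 3 = 1) {ω : F} (hω : ω ^ 2 + ω + 1 = 0) : σ ω = ω := by
  have h3 : ω ^ 3 = 1 := by linear_combination (ω - 1) * hω
  rw [h.apply, ← Nat.div_add_mod (2 * m + 1) 3, hq, pow_add, pow_mul, h3]
  ring

theorem apply_cube_root_of_mod_eq_two (h : IsQuadraticFrobenius p m σ)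
    (hq : (2 * m + 1) % 3 = 2) {ω : F} (hω : ω ^ 2 + ω + 1 = 0) : σ ω = ω ^ 2 := by
  have h3 : ω ^ 3 = 1 := by linear_combination (ω - 1) * hω
  rw [h.apply, ← Nat.div_add_mod (2 * m + 1) 3, hq, pow_add, pow_mul, h3]
  ring

theorem cube_root_ne_zero_and_ne_one (h : IsQuadraticFrobenius p m σ) {ω : F}
    (hω : ω ^ 2 + ω + 1 = 0) : ω ≠ 0 ∧ ω ≠ 1 := by
  refine ⟨?_, ?_⟩
  · rintro rfl
    simp at hω
  · rintro rfl
    exact h.three_ne_zero (by linear_combination hω)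

theorem exists_forms_ne_zero (h : IsQuadraticFrobenius p m σ) (a b : F) :
    ∃ y, y ≠ 0 ∧ σ y - a * y ≠ 0 ∧ σ y - b * y ≠ 0 := by
  have := h.two_le
  obtain ⟨u, hu, hne⟩ := h.exists_eval_ne_zero
    (mul_ne_zero (X_sub_C_ne_zero a) (X_sub_C_ne_zero b)) (by
      rw [natDegree_mul (X_sub_C_ne_zero _) (X_sub_C_ne_zero _), natDegree_X_sub_C,
        natDegree_X_sub_C]
      omega)
  obtain ⟨y, hy0, hy⟩ := h.exists_apply_eq_mul hu
  simp only [eval_mul, eval_sub, eval_X, eval_C] at hne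
  refine ⟨y, hy0, ?_, ?_⟩
  · rw [hy, ← sub_mul]
    exact mul_ne_zero (left_ne_zero_of_mul hne) hy0
  · rw [hy, ← sub_mul]
    exact mul_ne_zero (right_ne_zero_of_mul hne) hy0

/-- Condition (1) fails if multiplication of `ξ` by `ω` and of `η` by `ω²` is induced by a map
of the points. -/
theorem not_condition1_splitHessianCubic (h : IsQuadraticFrobenius p m σ) {a b w ω : F}
    (hω : ω ^ 2 + ω + 1 = 0)
    (hx : ∀ y, ∃ x, σ x - a * x = ω * (σ y - a * y) ∧ σ x - b * x = ω ^ 2 * (σ y - b * y)) :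
    ¬ Condition1 (2 * m + 1) 3 (splitHessianCubic a b w) := by
  rw [h.condition1_iff]
  intro H
  obtain ⟨hω0, hω1⟩ := h.cube_root_ne_zero_and_ne_one hω
  have h3 : ω ^ 3 = 1 := by linear_combination (ω - 1) * hω
  obtain ⟨y, hy0, hya, hyb⟩ := h.exists_forms_ne_zero a b
  obtain ⟨x, hxa, hxb⟩ := hx y
  have hx0 : x ≠ 0 := by
    rintro rfl
    refine mul_ne_zero hω0 hya ?_
    rw [← hxa]
    simp
  have key := H x y hx0 hy0 ?_
  · refine mul_ne_zero (mul_ne_zero (mul_ne_zero hω0 (sub_ne_zero.2 hω1)) hya) hyb ?_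
    linear_combination (σ y - b * y) * hxa - (σ y - a * y) * hxb + (a - b) * key
  · simp only [pow_three_mul_eval_splitHessianCubic, ← h.apply_eq_pow_mul]
    rw [hxa, hxb, mul_pow, mul_pow, ← pow_mul, mul_comm 2 3, pow_mul, h3, one_pow, one_mul,
      one_mul, mul_comm]

theorem not_condition1_splitHessianCubic_of_diag (h : IsQuadraticFrobenius p m σ)
    (hq : (2 * m + 1) % 3 = 1) {a b w : F} (hab : a ≠ b) (ha : a * σ a = 1) (hb : b * σ b = 1) :
    ¬ Condition1 (2 * m + 1) 3 (splitHessianCubic a b w) := by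
  obtain ⟨ω, hω⟩ := h.exists_cube_root
  refine h.not_condition1_splitHessianCubic hω fun y => ?_
  have hba := sub_ne_zero.2 hab.symm
  have hσba : σ b - σ a ≠ 0 := by
    rw [← map_sub]
    exact (map_ne_zero σ).2 hba
  obtain ⟨x, hx⟩ : ∃ x, x = (ω * (σ y - a * y) - ω ^ 2 * (σ y - b * y)) / (b - a) := ⟨_, rfl⟩
  rw [eq_div_iff hba] at hx
  have hσx : σ x * (b - a) = b * ω * (σ y - a * y) - a * ω ^ 2 * (σ y - b * y) := by
    have h1 := congrArg σ hx
    simp only [map_mul, map_sub, map_pow, h.involutive,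
      h.apply_cube_root_of_mod_eq_one hq hω] at h1
    apply mul_right_cancel₀ hσba
    linear_combination (b - a) * h1 + (ω - ω ^ 2) * ((a * y - σ y) * hb + (σ y - b * y) * ha)
  refine ⟨x, ?_, ?_⟩
  · apply mul_right_cancel₀ hba
    linear_combination hσx - a * hx
  · apply mul_right_cancel₀ hba
    linear_combination hσx - b * hx

theorem not_condition1_splitHessianCubic_of_antidiag (h : IsQuadraticFrobenius p m σ)
    (hq : (2 * m + 1) % 3 = 2) {a b w : F} (hab : a ≠ b) (ha : b * σ a = 1) :
    ¬ Condition1 (2 * m + 1) 3 (splitHessianCubic a b w) := by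
  obtain ⟨ω, hω⟩ := h.exists_cube_root
  have h3 : ω ^ 3 = 1 := by linear_combination (ω - 1) * hω
  have hb : a * σ b = 1 := by
    rw [← h.involutive a, ← map_mul, mul_comm, ha, map_one]
  refine h.not_condition1_splitHessianCubic hω fun y => ?_
  have hba := sub_ne_zero.2 hab.symm
  have hσba : σ b - σ a ≠ 0 := by
    rw [← map_sub]
    exact (map_ne_zero σ).2 hba
  obtain ⟨x, hx⟩ : ∃ x, x = (ω * (σ y - a * y) - ω ^ 2 * (σ y - b * y)) / (b - a) := ⟨_, rfl⟩
  rw [eq_div_iff hba] at hx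
  have hσx : σ x * (b - a) = b * ω * (σ y - a * y) - a * ω ^ 2 * (σ y - b * y) := by
    have h1 := congrArg σ hx
    simp only [map_mul, map_sub, map_pow, h.involutive,
      h.apply_cube_root_of_mod_eq_two hq hω] at h1
    apply mul_right_cancel₀ hσba
    linear_combination (b - a) * h1 + (ω ^ 2 - ω) * ((a * y - σ y) * ha + (σ y - b * y) * hb) -
      ω * (b - a) * (y - σ b * σ y) * h3
  refine ⟨x, ?_, ?_⟩
  · apply mul_right_cancel₀ hba
    linear_combination hσx - a * hx
  · apply mul_right_cancel₀ hba
    linear_combination hσx - b * hx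

theorem not_condition1_X_pow_three_sub_C (h : IsQuadraticFrobenius p m σ)
    (hq : (2 * m + 1) % 3 = 2) {w : F} : ¬ Condition1 (2 * m + 1) 3 (X ^ 3 - C w : F[X]) := by
  rw [h.condition1_iff]
  intro H
  obtain ⟨ω, hω⟩ := h.exists_cube_root
  obtain ⟨hω0, hω1⟩ := h.cube_root_ne_zero_and_ne_one hω
  have h3 : ω ^ 3 = 1 := by linear_combination (ω - 1) * hω
  have hpow : (ω ^ (2 * m)) ^ 3 = 1 := by rw [← pow_mul, mul_comm, pow_mul, h3, one_pow]
  have := H ω 1 hω0 one_ne_zero (by simpa [hpow, h3] using mul_comm _ _)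
  rw [h.apply_cube_root_of_mod_eq_two hq hω, map_one] at this
  refine mul_ne_zero hω0 (sub_ne_zero.2 hω1) ?_
  linear_combination -this

end IsQuadraticFrobenius

/-- An irreducible cubic over a finite field has a square discriminant. -/
theorem exists_discrim_eq_sq_of_irreducible {F : Type*} [Field F] [Finite F] {c₀ c₁ c₂ : F}
    (hirr : Irreducible (X ^ 3 + C c₂ * X ^ 2 + C c₁ * X + C c₀)) :
    ∃ e : F, e ≠ 0 ∧ e ^ 2 = c₂ ^ 2 * c₁ ^ 2 - 4 * c₁ ^ 3 - 4 * c₂ ^ 3 * c₀ + 18 * c₂ * c₁ * c₀ -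
      27 * c₀ ^ 2 := by
  set P : F[X] := X ^ 3 + C c₂ * X ^ 2 + C c₁ * X + C c₀ with hP
  have hdeg : P.natDegree = 3 := by rw [hP]; compute_degree!
  have : Fact (Irreducible P) := ⟨hirr⟩
  let L := AdjoinRoot P
  let _ := Fintype.ofFinite F
  have : Module.Finite F L := (AdjoinRoot.powerBasis hirr.ne_zero).finite
  have : Finite L := Module.finite_of_finite F
  have hrank : Module.finrank F L = 3 := by
    rw [(AdjoinRoot.powerBasis hirr.ne_zero).finrank, AdjoinRoot.powerBasis_dim, hdeg]
  let φ := FiniteField.frobeniusAlgEquivOfAlgebraic F L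
  have hfix : ∀ x, φ x = x → ∃ y, algebraMap F L y = x := by
    intro x hx
    change x ∈ Set.range (algebraMap F L)
    rw [← IntermediateField.mem_bot, IsGalois.mem_bot_iff_fixed]
    intro f
    obtain ⟨k, rfl⟩ := (FiniteField.bijective_frobeniusAlgEquivOfAlgebraic_pow F L).2 f
    change (φ ^ (k : ℕ)) x = x
    generalize (k : ℕ) = k
    induction k with
    | zero => rfl
    | succ k ih => rw [pow_succ, AlgEquiv.mul_apply]; exact (congrArg _ hx).trans ih
  have hφ3 : ∀ x, φ (φ (φ x)) = x := by
    intro x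
    have h1 : φ ^ 3 = 1 := by
      rw [← hrank, ← FiniteField.orderOf_frobeniusAlgEquivOfAlgebraic F L]
      exact pow_orderOf_eq_one _
    exact congrArg (fun f : L ≃ₐ[F] L => f x) h1
  let i := algebraMap F L
  have hroot : ∀ r : L, aeval r P = r ^ 3 + i c₂ * r ^ 2 + i c₁ * r + i c₀ := by
    intro r
    simp [hP, i]
  obtain ⟨r, hr⟩ : ∃ r : L, aeval r P = 0 := 
    ⟨AdjoinRoot.root P, (AdjoinRoot.aeval_eq P).trans AdjoinRoot.mk_self⟩
  have hr1 : aeval (φ r) P = 0 := by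
    rw [← AlgEquiv.coe_toAlgHom, aeval_algHom_apply, hr, map_zero]
  have hr2 : aeval (φ (φ r)) P = 0 := by
    rw [← AlgEquiv.coe_toAlgHom, aeval_algHom_apply, AlgEquiv.coe_toAlgHom, hr1, map_zero]
  have hne : φ r ≠ r := by
    intro h0
    obtain ⟨y, rfl⟩ := hfix r h0
    rw [aeval_algebraMap_apply, map_eq_zero] at hr
    have := Polynomial.degree_eq_one_of_irreducible_of_root hirr (x := y) (by simpa using hr)
    rw [degree_eq_natDegree hirr.ne_zero, hdeg] at this
    norm_cast at this
  have hne1 : φ (φ r) ≠ φ r := fun h0 => hne (φ.injective h0)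
  have hne2 : φ (φ r) ≠ r := fun h0 => hne ((congrArg φ h0).symm.trans (hφ3 r))
  generalize hs : φ r = s at *
  generalize ht : φ s = t at *
  have ht3 : φ t = r := by rw [← ht, ← hs, hφ3]
  rw [hroot] at hr hr1 hr2
  obtain ⟨e, he⟩ := hfix ((r - s) * (r - t) * (s - t)) (by
    simp only [map_mul, map_sub, hs, ht, ht3]; ring)
  have e1 : r ^ 2 + r * s + s ^ 2 + i c₂ * (r + s) + i c₁ = 0 := by
    apply mul_left_cancel₀ (sub_ne_zero.2 hne)
    linear_combination hr1 - hr
  have e2 : r ^ 2 + r * t + t ^ 2 + i c₂ * (r + t) + i c₁ = 0 := by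
    apply mul_left_cancel₀ (sub_ne_zero.2 hne2)
    linear_combination hr2 - hr
  have e3 : i c₂ = -(r + s + t) := by
    apply mul_left_cancel₀ (sub_ne_zero.2 hne1)
    linear_combination e2 - e1
  have e4 : i c₁ = r * s + r * t + s * t := by
    rw [e3] at e1
    linear_combination e1
  have e5 : i c₀ = -(r * s * t) := by
    rw [e3, e4] at hr
    linear_combination hr
  refine ⟨e, ?_, (algebraMap F L).injective ?_⟩
  · rintro rfl
    rw [map_zero, eq_comm] at he
    exact mul_ne_zero (mul_ne_zero (sub_ne_zero.2 hne.symm) (sub_ne_zero.2 hne2.symm))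
      (sub_ne_zero.2 hne1.symm) he
  simp only [map_pow, map_sub, map_add, map_mul, map_ofNat, he]
  change _ = i c₂ ^ 2 * i c₁ ^ 2 - 4 * i c₁ ^ 3 - 4 * i c₂ ^ 3 * i c₀ + 18 * i c₂ * i c₁ * i c₀ -
    27 * i c₀ ^ 2
  rw [e3, e4, e5]
  ring

namespace IsQuadraticFrobenius

variable {F : Type*} [Field F] {p m : ℕ} {σ : F →+* F}

theorem diag_or_antidiag_of_condition1_splitHessianCubic (h : IsQuadraticFrobenius p m σ)
    {a b w : F} (hab : a ≠ b) (hw : ∀ z, z ^ 3 ≠ w) (hirr : Irreducible (splitHessianCubic a b w))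
    (hdeg : (splitHessianCubic a b w).natDegree = 3)
    (hcond : Condition1 (2 * m + 1) 3 (splitHessianCubic a b w)) :
    a * σ a = 1 ∧ b * σ b = 1 ∨ b * σ a = 1 := by
  have hba := sub_ne_zero.2 hab
  have hw1 : (1 - w)⁻¹ ≠ 0 := inv_ne_zero (sub_ne_zero.2 fun h1 => hw 1 (by rw [← h1]; ring))
  have key := h.conjReverse_diag_or_antidiag (α := 1) (β := -a) (γ := 1) (δ := -b)
    (a := -σ a - (1 - a * σ a) / (a - b)) (b := (1 - a * σ a) / (a - b))
    (c := -σ b - (1 - a * σ b) / (a - b)) (d := (1 - a * σ b) / (a - b))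
    hw1 (by contrapose! hba; linear_combination hba) hw
    (by simp only [splitHessianCubic, map_neg, C_1]; ring) hirr hdeg hcond
    (by rw [map_neg]; ring) (by rw [map_one]; field_simp; ring)
    (by rw [map_neg]; ring) (by rw [map_one]; field_simp; ring)
  rcases key with ⟨h1, h2⟩ | ⟨h1, h2⟩
  · left
    rw [div_eq_zero_iff, or_iff_left hba] at h1
    field_simp at h2
    exact ⟨by linear_combination -h1, by linear_combination h2⟩
  · right
    field_simp at h1
    linear_combination h1

theorem eq_zero_of_condition1_X_sub_C_pow_sub_C (h : IsQuadraticFrobenius p m σ)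
    {b w : F} (hw : ∀ z, z ^ 3 ≠ w) (hirr : Irreducible ((X - C b) ^ 3 - C w))
    (hdeg : ((X - C b) ^ 3 - C w).natDegree = 3)
    (hcond : Condition1 (2 * m + 1) 3 ((X - C b) ^ 3 - C w)) : b = 0 := by
  have key := h.conjReverse_diag_or_antidiag (α := 1) (β := -b) (γ := 0) (δ := 1)
    (a := -σ b) (b := 1 - b * σ b) (c := 1) (d := b)
    one_ne_zero (by simp) hw
    (by simp only [map_neg, C_1, C_0]; ring) hirr hdeg hcond
    (by rw [map_neg]; ring) (by rw [map_one]; ring)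
    (by rw [map_one]; ring) (by rw [map_zero]; ring)
  rcases key with ⟨_, h2⟩ | ⟨_, h2⟩
  · exact absurd h2 one_ne_zero
  · exact h2

end IsQuadraticFrobenius

theorem monic_cubic {R : Type*} [CommRing R] [Nontrivial R] (c₂ c₁ c₀ : R) :
    (X ^ 3 + C c₂ * X ^ 2 + C c₁ * X + C c₀).Monic := by
  monicity!

theorem natDegree_monic_cubic {R : Type*} [CommRing R] [Nontrivial R] (c₂ c₁ c₀ : R) :
    (X ^ 3 + C c₂ * X ^ 2 + C c₁ * X + C c₀).natDegree = 3 := by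
  compute_degree!

theorem eq_monic_cubic {R : Type*} [CommRing R] {P : R[X]} (hP : P.Monic)
    (hdeg : P.natDegree = 3) :
    P = X ^ 3 + C (P.coeff 2) * X ^ 2 + C (P.coeff 1) * X + C (P.coeff 0) := by
  have h3 : P.coeff 3 = 1 := by rw [← hdeg]; exact hP
  conv_lhs => rw [P.as_sum_range_C_mul_X_pow, hdeg]
  simp only [Finset.sum_range_succ, Finset.sum_range_zero, h3, C_1]
  ring

theorem monic_cubic_injective {R : Type*} [CommRing R] {c₂ c₁ c₀ d₂ d₁ d₀ : R}
    (H : X ^ 3 + C c₂ * X ^ 2 + C c₁ * X + C c₀ = X ^ 3 + C d₂ * X ^ 2 + C d₁ * X + C d₀) :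
    c₂ = d₂ ∧ c₁ = d₁ ∧ c₀ = d₀ := by
  refine ⟨?_, ?_, ?_⟩
  · simpa [coeff_X, coeff_C] using congrArg (fun P => coeff P 2) H
  · simpa [coeff_X, coeff_C] using congrArg (fun P => coeff P 1) H
  · simpa [coeff_X, coeff_C] using congrArg (fun P => coeff P 0) H

section

variable {F : Type*} [Field F]

theorem eval_ne_zero_of_irreducible_of_natDegree_eq_three {P : F[X]} (hP : Irreducible P)
    (hdeg : P.natDegree = 3) (x : F) : P.eval x ≠ 0 := by
  intro h0
  have := degree_eq_one_of_irreducible_of_root hP h0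
  rw [degree_eq_natDegree hP.ne_zero, hdeg] at this
  norm_cast at this

theorem irreducible_of_natDegree_eq_three {P : F[X]} (hdeg : P.natDegree = 3)
    (h : ∀ x, P.eval x ≠ 0) : Irreducible P := by
  rw [irreducible_iff_roots_eq_zero_of_degree_le_three (by omega) (by omega),
    Multiset.eq_zero_iff_forall_notMem]
  exact fun x hx => h x (isRoot_of_mem_roots hx)

theorem ne_one_of_forall_pow_three_ne {w : F} (hw : ∀ z, z ^ 3 ≠ w) : w ≠ 1 :=
  fun h1 => hw 1 (by rw [h1, one_pow])

theorem ne_zero_of_forall_pow_three_ne {w : F} (hw : ∀ z, z ^ 3 ≠ w) : w ≠ 0 :=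
  fun h0 => hw 0 (by rw [h0, zero_pow three_ne_zero])

theorem splitHessianCubic_eq {w : F} (hw : w ≠ 1) (a b : F) :
    splitHessianCubic a b w = X ^ 3 + C (-3 * (a - w * b) / (1 - w)) * X ^ 2 +
      C (3 * (a ^ 2 - w * b ^ 2) / (1 - w)) * X + C (-(a ^ 3 - w * b ^ 3) / (1 - w)) := by
  have hw1 := sub_ne_zero.2 hw.symm
  have h1 : (C (1 - w)⁻¹ : F[X]) * (1 - C w) = 1 := by
    rw [← C_1, ← C_sub, ← C_mul, inv_mul_cancel₀ hw1]
  simp only [splitHessianCubic, div_eq_mul_inv, C_mul, C_sub, C_neg, C_pow, map_ofNat]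
  linear_combination X ^ 3 * h1

theorem splitHessianCubic_swap {w : F} (hw0 : w ≠ 0) (hw : w ≠ 1) (a b : F) :
    splitHessianCubic b a w⁻¹ = splitHessianCubic a b w := by
  have hw1 := sub_ne_zero.2 hw.symm
  have hw3 : 1 - w⁻¹ ≠ 0 := by
    rw [sub_ne_zero, ne_comm, inv_ne_one]
    exact hw
  rw [splitHessianCubic_eq hw, splitHessianCubic_eq (by rwa [inv_ne_one])]
  have e2 : -3 * (b - w⁻¹ * a) / (1 - w⁻¹) = -3 * (a - w * b) / (1 - w) := by
    rw [div_eq_div_iff hw3 hw1]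
    field_simp
    ring
  have e1 : 3 * (b ^ 2 - w⁻¹ * a ^ 2) / (1 - w⁻¹) = 3 * (a ^ 2 - w * b ^ 2) / (1 - w) := by
    rw [div_eq_div_iff hw3 hw1]
    field_simp
    ring
  have e0 : -(b ^ 3 - w⁻¹ * a ^ 3) / (1 - w⁻¹) = -(a ^ 3 - w * b ^ 3) / (1 - w) := by
    rw [div_eq_div_iff hw3 hw1]
    field_simp
    ring
  rw [e2, e1, e0]

theorem monic_splitHessianCubic {w : F} (hw : w ≠ 1) (a b : F) :
    (splitHessianCubic a b w).Monic := by
  rw [splitHessianCubic_eq hw]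
  exact monic_cubic _ _ _

theorem natDegree_splitHessianCubic {w : F} (hw : w ≠ 1) (a b : F) :
    (splitHessianCubic a b w).natDegree = 3 := by
  rw [splitHessianCubic_eq hw]
  exact natDegree_monic_cubic _ _ _

theorem eval_splitHessianCubic (a b w u : F) :
    (splitHessianCubic a b w).eval u = (1 - w)⁻¹ * ((u - a) ^ 3 - w * (u - b) ^ 3) := by
  simp [splitHessianCubic]

theorem irreducible_splitHessianCubic {a b w : F} (hab : a ≠ b) (hw : ∀ z, z ^ 3 ≠ w) :
    Irreducible (splitHessianCubic a b w) := by
  have hw1 := ne_one_of_forall_pow_three_ne hw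
  refine irreducible_of_natDegree_eq_three (natDegree_splitHessianCubic hw1 a b) fun x hx => ?_
  rw [eval_splitHessianCubic, mul_eq_zero, or_iff_right (inv_ne_zero (sub_ne_zero.2 hw1.symm))]
    at hx
  have hxb : x - b ≠ 0 := by
    intro h0
    rw [h0, zero_pow three_ne_zero, mul_zero, sub_zero] at hx
    exact hab (by linear_combination h0 - (pow_eq_zero_iff three_ne_zero).1 hx)
  refine hw ((x - a) / (x - b)) ?_
  rw [div_pow, div_eq_iff (pow_ne_zero 3 hxb)]
  linear_combination hx

theorem forall_pow_three_ne_of_irreducible_splitHessianCubic {a b w : F} (hw : w ≠ 1)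
    (hirr : Irreducible (splitHessianCubic a b w)) (z : F) : z ^ 3 ≠ w := by
  rintro rfl
  have hz : 1 - z ≠ 0 := by
    contrapose! hw
    rw [← sub_eq_zero.1 hw, one_pow]
  refine eval_ne_zero_of_irreducible_of_natDegree_eq_three hirr
    (natDegree_splitHessianCubic hw a b) ((a - z * b) / (1 - z)) ?_
  rw [eval_splitHessianCubic, ← mul_pow]
  have : (a - z * b) / (1 - z) - a = z * ((a - z * b) / (1 - z) - b) := by
    field_simp
    ring
  rw [this, sub_self, mul_zero]

theorem X_pow_three_sub_C_eq (w : F) :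
    (X ^ 3 - C w : F[X]) = X ^ 3 + C 0 * X ^ 2 + C 0 * X + C (-w) := by
  simp [sub_eq_add_neg]

theorem irreducible_X_pow_three_sub_C {w : F} (hw : ∀ z, z ^ 3 ≠ w) :
    Irreducible (X ^ 3 - C w : F[X]) := by
  refine irreducible_of_natDegree_eq_three (by compute_degree!) fun x hx => hw x ?_
  simpa [sub_eq_zero] using hx

end

namespace IsQuadraticFrobenius

variable {F : Type*} [Field F] {p m : ℕ} {σ : F →+* F}

theorem hessian_splitHessianCubic {w : F} (hw : w ≠ 1) (a b : F) {c₂ c₁ c₀ : F}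
    (h₂ : c₂ = -3 * (a - w * b) / (1 - w)) (h₁ : c₁ = 3 * (a ^ 2 - w * b ^ 2) / (1 - w))
    (h₀ : c₀ = -(a ^ 3 - w * b ^ 3) / (1 - w)) :
    (1 - w) ^ 2 * (c₂ ^ 2 - 3 * c₁) = 9 * w * (a - b) ^ 2 ∧
    c₁ * c₂ - 9 * c₀ = -(a + b) * (c₂ ^ 2 - 3 * c₁) ∧
    c₁ ^ 2 - 3 * c₂ * c₀ = a * b * (c₂ ^ 2 - 3 * c₁) := by
  have hw1 := sub_ne_zero.2 hw.symm
  subst h₂ h₁ h₀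
  refine ⟨?_, ?_, ?_⟩ <;> field_simp <;> ring

theorem splitHessianCubic_injective (h : IsQuadraticFrobenius p m σ) {a b w a' b' w' : F}
    (hab : a ≠ b) (hw0 : w ≠ 0) (hw : w ≠ 1) (hw' : w' ≠ 1)
    (H : splitHessianCubic a b w = splitHessianCubic a' b' w') :
    (a' = a ∧ b' = b ∧ w' = w) ∨ (a' = b ∧ b' = a ∧ w' = w⁻¹) := by
  have same : ∀ {a b w w' : F}, a ≠ b → w ≠ 1 → w' ≠ 1 →
      splitHessianCubic a b w = splitHessianCubic a b w' → w' = w := by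
    intro a b w w' hab hw hw' H
    rw [splitHessianCubic_eq hw, splitHessianCubic_eq hw'] at H
    obtain ⟨H, _, _⟩ := monic_cubic_injective H
    rw [div_eq_div_iff (sub_ne_zero.2 hw.symm) (sub_ne_zero.2 hw'.symm)] at H
    apply mul_left_cancel₀ (mul_ne_zero h.three_ne_zero (sub_ne_zero.2 hab))
    linear_combination H
  have H1 := H
  rw [splitHessianCubic_eq hw, splitHessianCubic_eq hw'] at H1
  obtain ⟨H2, H1, H0⟩ := monic_cubic_injective H1
  obtain ⟨k2, k1, k0⟩ := hessian_splitHessianCubic hw a b rfl rfl rfl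
  obtain ⟨-, k1', k0'⟩ := hessian_splitHessianCubic hw' a' b' H2 H1 H0
  have hne : (-3 * (a - w * b) / (1 - w)) ^ 2 - 3 * (3 * (a ^ 2 - w * b ^ 2) / (1 - w)) ≠ 0 := by
    intro h0
    rw [h0, mul_zero] at k2
    refine mul_ne_zero (mul_ne_zero (pow_ne_zero 2 h.three_ne_zero) hw0)
      (pow_ne_zero 2 (sub_ne_zero.2 hab)) ?_
    linear_combination -k2
  have hsum : a' + b' = a + b := by
    apply mul_right_cancel₀ hne
    linear_combination k1' - k1
  have hprod : a' * b' = a * b := by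
    apply mul_right_cancel₀ hne
    rw [← k0, ← k0']
  have : (a' - a) * (a' - b) = 0 := by linear_combination a' * hsum - hprod
  rcases mul_eq_zero.1 this with h0 | h0
  · obtain rfl : a' = a := sub_eq_zero.1 h0
    obtain rfl : b' = b := by linear_combination hsum
    exact Or.inl ⟨rfl, rfl, same hab hw hw' H⟩
  · obtain rfl : a' = b := sub_eq_zero.1 h0
    obtain rfl : b' = a := by linear_combination hsum
    rw [← splitHessianCubic_swap hw0 hw] at H
    exact Or.inr ⟨rfl, rfl, same hab.symm (by rwa [inv_ne_one]) hw' H⟩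

theorem splitHessianCubic_ne_X_pow_three_sub_C (h : IsQuadraticFrobenius p m σ) {a b w w' : F}
    (hab : a ≠ b) (hw0 : w ≠ 0) (hw : w ≠ 1) : splitHessianCubic a b w ≠ X ^ 3 - C w' := by
  intro H
  rw [splitHessianCubic_eq hw, X_pow_three_sub_C_eq] at H
  obtain ⟨H2, H1, _⟩ := monic_cubic_injective H
  obtain ⟨k2, -⟩ := hessian_splitHessianCubic hw a b rfl rfl rfl
  rw [H1, H2] at k2
  refine mul_ne_zero (mul_ne_zero (pow_ne_zero 2 h.three_ne_zero) hw0)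
    (pow_ne_zero 2 (sub_ne_zero.2 hab)) ?_
  linear_combination -k2

/-- A monic irreducible cubic is a combination of the cubes of two forms over the ground field. -/
theorem exists_splitHessianCubic_or_exists_X_sub_C (h : IsQuadraticFrobenius p m σ) [Finite F]
    {P : F[X]} (hP : P.Monic) (hdeg : P.natDegree = 3) (hirr : Irreducible P) :
    (∃ a b w, a ≠ b ∧ (∀ z, z ^ 3 ≠ w) ∧ P = splitHessianCubic a b w) ∨
      ∃ b w, (∀ z, z ^ 3 ≠ w) ∧ P = (X - C b) ^ 3 - C w := by
  have h3 := h.three_ne_zero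
  have h2 := h.two_ne_zero
  have hroot := eval_ne_zero_of_irreducible_of_natDegree_eq_three hirr hdeg
  have hPeq := eq_monic_cubic hP hdeg
  generalize P.coeff 2 = c₂ at hPeq
  generalize P.coeff 1 = c₁ at hPeq
  generalize P.coeff 0 = c₀ at hPeq
  by_cases h₂ : c₂ ^ 2 - 3 * c₁ = 0
  · right
    have hP' : P = (X - C (-c₂ / 3)) ^ 3 - C ((c₂ / 3) ^ 3 - c₀) := by
      obtain ⟨d, rfl⟩ : ∃ d, c₂ = 3 * d := ⟨c₂ / 3, by field_simp⟩
      obtain rfl : c₁ = 3 * d ^ 2 := by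
        apply mul_left_cancel₀ h3
        linear_combination -h₂
      rw [hPeq, ← mul_neg, mul_div_cancel_left₀ _ h3, mul_div_cancel_left₀ _ h3]
      simp only [C_mul, C_neg, C_pow, C_sub, map_ofNat]
      ring
    refine ⟨_, _, fun z hz => ?_, hP'⟩
    apply hroot (-c₂ / 3 + z)
    rw [hP']
    simp [hz]
  left
  obtain ⟨e, he0, he⟩ := exists_discrim_eq_sq_of_irreducible (hPeq ▸ hirr)
  obtain ⟨τ, hτ⟩ := h.exists_sq_eq_neg_three
  have hτ0 : τ ≠ 0 := by
    rintro rfl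
    exact h3 (by linear_combination hτ)
  obtain ⟨a, ha⟩ : ∃ a, 2 * (c₂ ^ 2 - 3 * c₁) * a = -(c₁ * c₂ - 9 * c₀) + τ * e :=
    ⟨_, mul_div_cancel₀ _ (mul_ne_zero h2 h₂)⟩
  obtain ⟨b, hb⟩ : ∃ b, 2 * (c₂ ^ 2 - 3 * c₁) * b = -(c₁ * c₂ - 9 * c₀) - τ * e :=
    ⟨_, mul_div_cancel₀ _ (mul_ne_zero h2 h₂)⟩
  have hab : a ≠ b := by
    rintro rfl
    refine mul_ne_zero h2 (mul_ne_zero hτ0 he0) ?_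
    linear_combination hb - ha
  have hsum : (c₂ ^ 2 - 3 * c₁) * (a + b) = -(c₁ * c₂ - 9 * c₀) := by
    apply mul_left_cancel₀ h2
    linear_combination ha + hb
  have hprod : (c₂ ^ 2 - 3 * c₁) * (a * b) = c₁ ^ 2 - 3 * c₂ * c₀ := by
    apply mul_left_cancel₀ (mul_ne_zero (mul_ne_zero h2 h2) h₂)
    linear_combination 2 * (c₂ ^ 2 - 3 * c₁) * b * ha +
      (-(c₁ * c₂ - 9 * c₀) + τ * e) * hb - e ^ 2 * hτ + 3 * he
  have hba : b - a ≠ 0 := sub_ne_zero.2 hab.symm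
  obtain ⟨k, hk⟩ : ∃ k, 3 * (b - a) * k = c₂ + 3 * b :=
    ⟨_, mul_div_cancel₀ _ (mul_ne_zero h3 hba)⟩
  have e2 : c₂ = -3 * (k * a + (1 - k) * b) := by linear_combination -hk
  have e1 : c₁ = 3 * (k * a ^ 2 + (1 - k) * b ^ 2) := by
    apply mul_left_cancel₀ h₂
    linear_combination (k * a + (1 - k) * b) * (-3) * hsum + 3 * hprod + (c₁ * c₂ - 9 * c₀) * e2
  have e0 : c₀ = -(k * a ^ 3 + (1 - k) * b ^ 3) := by
    apply mul_left_cancel₀ (mul_ne_zero h3 h₂)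
    linear_combination 3 * (k * a ^ 2 + (1 - k) * b ^ 2) * hsum -
      3 * (k * a + (1 - k) * b) * hprod + (c₁ * c₂ - 9 * c₀) * e1 -
      (c₁ ^ 2 - 3 * c₂ * c₀) * e2
  have hPk : ∀ x, P.eval x = k * (x - a) ^ 3 + (1 - k) * (x - b) ^ 3 := by
    intro x
    rw [hPeq, e2, e1, e0]
    simp
    ring
  have hk0 : k ≠ 0 := by
    rintro rfl
    apply hroot b
    rw [hPk]
    ring
  have hw : -(1 - k) / k ≠ 1 := by
    rw [Ne, div_eq_one_iff_eq hk0]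
    intro h0
    exact one_ne_zero (α := F) (by linear_combination -h0)
  have hPs : P = splitHessianCubic a b (-(1 - k) / k) := by
    have h1 : 1 - -(1 - k) / k = k⁻¹ := by field_simp; ring
    have f2 : -3 * (a - -(1 - k) / k * b) / k⁻¹ = c₂ := by
      rw [e2, div_inv_eq_mul]
      field_simp
      ring
    have f1 : 3 * (a ^ 2 - -(1 - k) / k * b ^ 2) / k⁻¹ = c₁ := by
      rw [e1, div_inv_eq_mul]
      field_simp
      ring
    have f0 : -(a ^ 3 - -(1 - k) / k * b ^ 3) / k⁻¹ = c₀ := by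
      rw [e0, div_inv_eq_mul]
      field_simp
      ring
    rw [splitHessianCubic_eq hw, h1, f2, f1, f0, hPeq]
  exact ⟨a, b, _, hab,
    forall_pow_three_ne_of_irreducible_splitHessianCubic hw (hPs ▸ hirr), hPs⟩

end IsQuadraticFrobenius

/-- A map all of whose fibres have `k` elements. -/
theorem mul_card_image_of_card_fiber {α β : Type*} [DecidableEq β] {s : Finset α} {f : α → β}
    {k : ℕ} (h : ∀ a ∈ s, (s.filter fun x => f x = f a).card = k) :
    k * (s.image f).card = s.card := by
  rw [Finset.card_eq_sum_card_image f s, mul_comm]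
  refine (Finset.sum_const_nat fun b hb => ?_).symm
  obtain ⟨a, ha, rfl⟩ := Finset.mem_image.1 hb
  exact h a ha

namespace IsQuadraticFrobenius

variable {F : Type*} [Field F] {p m : ℕ} {σ : F →+* F}

theorem three_mul_card_noncubes [Fintype F] [DecidableEq F]
    (h : IsQuadraticFrobenius p m σ) :
    3 * (Finset.univ.filter fun w : F => ∀ z, z ^ 3 ≠ w).card = 2 * (Fintype.card F - 1) := by
  obtain ⟨ω, hω⟩ := h.exists_cube_root
  obtain ⟨hω0, hω1⟩ := h.cube_root_ne_zero_and_ne_one hω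
  have h3 : ω ^ 3 = 1 := by linear_combination (ω - 1) * hω
  let U : Finset F := Finset.univ.erase 0
  have hU : U.card = Fintype.card F - 1 := by
    rw [Finset.card_erase_of_mem (Finset.mem_univ _), Finset.card_univ]
  have himage : 3 * (U.image fun z => z ^ 3).card = U.card := by
    refine mul_card_image_of_card_fiber fun a ha => ?_
    have ha0 : a ≠ 0 := Finset.ne_of_mem_erase ha
    refine Finset.card_eq_three.2 ⟨a, ω * a, ω ^ 2 * a, ?_, ?_, ?_, ?_⟩
    · exact fun h0 => hω1 (mul_right_cancel₀ ha0 (by rw [← h0, one_mul]))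
    · intro h0
      have h1 : ω ^ 2 = 1 := mul_right_cancel₀ ha0 (by rw [← h0, one_mul])
      exact hω1 (by rw [← h3, pow_succ, h1, one_mul])
    · intro h0
      have h1 : ω * 1 = ω * ω := mul_right_cancel₀ ha0 (by rw [mul_one, h0, sq])
      exact hω1 (mul_left_cancel₀ hω0 h1).symm
    · ext x
      simp only [Finset.mem_filter, Finset.mem_insert, Finset.mem_singleton, U, Finset.mem_erase,
        Finset.mem_univ, and_true]
      constructor
      · rintro ⟨-, hx⟩
        have : (x - a) * ((x - ω * a) * (x - ω ^ 2 * a)) = 0 := by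
          linear_combination hx - (x - a) * (x * a * hω) + (x - a) * a ^ 2 * h3
        rcases mul_eq_zero.1 this with h1 | h1
        · exact Or.inl (sub_eq_zero.1 h1)
        · rcases mul_eq_zero.1 h1 with h1 | h1
          · exact Or.inr (Or.inl (sub_eq_zero.1 h1))
          · exact Or.inr (Or.inr (sub_eq_zero.1 h1))
      · rintro (rfl | rfl | rfl)
        · exact ⟨ha0, rfl⟩
        · exact ⟨mul_ne_zero hω0 ha0, by rw [mul_pow, h3, one_mul]⟩
        · exact ⟨mul_ne_zero (pow_ne_zero 2 hω0) ha0, by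
            rw [mul_pow, ← pow_mul, mul_comm 2 3, pow_mul, h3, one_pow, one_mul]⟩
  have hsplit : (Finset.univ.filter fun w : F => ∀ z, z ^ 3 ≠ w) =
      U \ U.image fun z => z ^ 3 := by
    ext w
    simp only [Finset.mem_filter, Finset.mem_univ, true_and, Finset.mem_sdiff, Finset.mem_image,
      not_exists, not_and, U, Finset.mem_erase, and_true]
    constructor
    · exact fun hw => ⟨ne_zero_of_forall_pow_three_ne hw, fun z _ => hw z⟩
    · rintro ⟨hw0, hw⟩ z rfl
      exact hw z (fun hz => hw0 (by rw [hz, zero_pow (Nat.succ_ne_zero 2)])) rfl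
  have hsub : (U.image fun z => z ^ 3) ⊆ U := by
    intro w hw
    obtain ⟨z, hz, rfl⟩ := Finset.mem_image.1 hw
    exact Finset.mem_erase.2 ⟨pow_ne_zero 3 (Finset.ne_of_mem_erase hz), Finset.mem_univ _⟩
  rw [hsplit, Finset.card_sdiff_of_subset hsub]
  omega

theorem card_norm_one [Fintype F] [DecidableEq F]
    (h : IsQuadraticFrobenius p m σ) :
    (Finset.univ.filter fun u : F => u * σ u = 1).card = 2 * m + 2 := by
  obtain ⟨ζ, hζ⟩ := h.exists_primitive
  rw [← hζ.card_nthRootsFinset]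
  congr 1
  ext u
  rw [Finset.mem_filter, mem_nthRootsFinset (by omega), ← h.mul_apply_eq_one_iff]
  simp

theorem two_mul_card_image_splitHessianCubic [DecidableEq F]
    (h : IsQuadraticFrobenius p m σ) {S : Finset (F × F)} (hS : ∀ x ∈ S, x.1 ≠ x.2) (hswap : ∀ x ∈ S, x.swap ∈ S)
    {W : Finset F} (hW : ∀ w, w ∈ W ↔ ∀ z, z ^ 3 ≠ w) [DecidableEq F[X]] :
    2 * ((S ×ˢ W).image fun x => splitHessianCubic x.1.1 x.1.2 x.2).card = S.card * W.card := by
  rw [← Finset.card_product]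
  refine mul_card_image_of_card_fiber ?_
  rintro ⟨⟨a, b⟩, w⟩ hx
  obtain ⟨hab, hw⟩ := Finset.mem_product.1 hx
  have hne := hS _ hab
  have hw0 := ne_zero_of_forall_pow_three_ne ((hW w).1 hw)
  have hw1 := ne_one_of_forall_pow_three_ne ((hW w).1 hw)
  refine Finset.card_eq_two.2 ⟨((a, b), w), ((b, a), w⁻¹), ?_, ?_⟩
  · exact fun h0 => hne (congrArg (fun x => x.1.1) h0)
  ext ⟨⟨a', b'⟩, w'⟩
  simp only [Finset.mem_filter, Finset.mem_product, Finset.mem_insert, Finset.mem_singleton,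
    Prod.mk.injEq, and_assoc]
  constructor
  · rintro ⟨_, hw', H⟩
    exact h.splitHessianCubic_injective hne hw0 hw1
      (ne_one_of_forall_pow_three_ne ((hW w').1 hw')) H.symm
  · rintro (⟨rfl, rfl, rfl⟩ | ⟨rfl, rfl, rfl⟩)
    · exact ⟨hab, hw, rfl⟩
    · refine ⟨hswap _ hab, (hW _).2 fun z hz => (hW w).1 hw z⁻¹ ?_,
        splitHessianCubic_swap hw0 hw1 _ _⟩
      rw [inv_pow, hz, inv_inv]

theorem eq_splitHessianCubic_or_eq_X_pow_three_sub_C [Finite F]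
    (h : IsQuadraticFrobenius p m σ) {P : F[X]} (hP : P.Monic) (hdeg : P.natDegree = 3) (hirr : Irreducible P)
    (hcond : Condition1 (2 * m + 1) 3 P) :
    (∃ a b w, a ≠ b ∧ (∀ z, z ^ 3 ≠ w) ∧ P = splitHessianCubic a b w ∧
      (a * σ a = 1 ∧ b * σ b = 1 ∨ b * σ a = 1)) ∨
      ∃ w, (∀ z, z ^ 3 ≠ w) ∧ P = X ^ 3 - C w := by
  rcases h.exists_splitHessianCubic_or_exists_X_sub_C hP hdeg hirr with
    ⟨a, b, w, hab, hw, rfl⟩ | ⟨b, w, hw, rfl⟩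
  · exact Or.inl ⟨a, b, w, hab, hw, rfl,
      h.diag_or_antidiag_of_condition1_splitHessianCubic hab hw hirr hdeg hcond⟩
  · obtain rfl := h.eq_zero_of_condition1_X_sub_C_pow_sub_C hw hirr hdeg hcond
    exact Or.inr ⟨w, hw, by rw [C_0, sub_zero]⟩

theorem three_mul_ncard_of_mod_eq_two [Fintype F]
    (h : IsQuadraticFrobenius p m σ)
    (hcard : Fintype.card F = (2 * m + 1) ^ 2) (hq : (2 * m + 1) % 3 = 2) :
    3 * Set.ncard {P : F[X] |
      P.Monic ∧ P.natDegree = 3 ∧ Irreducible P ∧ Condition1 (2 * m + 1) 3 P} =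
      (2 * m + 1) * (2 * m) * (2 * m + 2) ^ 2 := by
  classical
  have hW3 := h.three_mul_card_noncubes
  set W := Finset.univ.filter fun w : F => ∀ z, z ^ 3 ≠ w with hWdef
  have hW : ∀ w, w ∈ W ↔ ∀ z, z ^ 3 ≠ w := by simp [hWdef]
  set μ := Finset.univ.filter fun u : F => u * σ u = 1 with hμdef
  have hμ : ∀ u, u ∈ μ ↔ u * σ u = 1 := by simp [hμdef]
  have hset : {P : F[X] |
      P.Monic ∧ P.natDegree = 3 ∧ Irreducible P ∧ Condition1 (2 * m + 1) 3 P} =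
      ((μ.offDiag ×ˢ W).image fun x => splitHessianCubic x.1.1 x.1.2 x.2) := by
    ext P
    simp only [Set.mem_ofPred_eq, Finset.coe_image, Set.mem_image, Finset.mem_coe,
      Finset.mem_product, Finset.mem_offDiag, Prod.exists]
    constructor
    · rintro ⟨hP, hdeg, hirr, hcond⟩
      rcases h.eq_splitHessianCubic_or_eq_X_pow_three_sub_C hP hdeg hirr hcond with
        ⟨a, b, w, hab, hw, rfl, ⟨ha, hb⟩ | ha⟩ | ⟨w, hw, rfl⟩
      · exact ⟨a, b, w, ⟨⟨(hμ a).2 ha, (hμ b).2 hb, hab⟩, (hW w).2 hw⟩, rfl⟩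
      · exact absurd hcond (h.not_condition1_splitHessianCubic_of_antidiag hq hab ha)
      · exact absurd hcond (h.not_condition1_X_pow_three_sub_C hq)
    · rintro ⟨a, b, w, ⟨⟨ha, hb, hab⟩, hw⟩, rfl⟩
      rw [hμ] at ha hb
      rw [hW] at hw
      have hw1 := ne_one_of_forall_pow_three_ne hw
      exact ⟨monic_splitHessianCubic hw1 a b, natDegree_splitHessianCubic hw1 a b,
        irreducible_splitHessianCubic hab hw,
        h.condition1_splitHessianCubic_of_diag hq hw hab ha hb⟩
  have hcount := h.two_mul_card_image_splitHessianCubic (S := μ.offDiag) (W := W)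
    (fun x hx => (Finset.mem_offDiag.1 hx).2.2)
    (fun x hx => by
      obtain ⟨h1, h2, h3⟩ := Finset.mem_offDiag.1 hx
      exact Finset.mem_offDiag.2 ⟨h2, h1, h3.symm⟩) hW
  rw [Finset.offDiag_card, h.card_norm_one] at hcount
  rw [hset, Set.ncard_coe_finset]
  have e1 : (2 * m + 2) * (2 * m + 2) - (2 * m + 2) = (2 * m + 2) * (2 * m + 1) := by
    rw [← Nat.mul_sub_one]
    rfl
  have e2 : (2 * m + 1) ^ 2 - 1 = 2 * m * (2 * m + 2) := by
    rw [Nat.sub_eq_iff_eq_add (Nat.one_le_pow _ _ (by omega))]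
    ring
  rw [e1] at hcount
  rw [hcard, e2] at hW3
  apply Nat.eq_of_mul_eq_mul_left (Nat.zero_lt_two)
  linear_combination 3 * hcount + (2 * m + 2) * (2 * m + 1) * hW3

theorem three_mul_ncard_of_mod_eq_one [Fintype F]
    (h : IsQuadraticFrobenius p m σ)
    (hcard : Fintype.card F = (2 * m + 1) ^ 2) (hq : (2 * m + 1) % 3 = 1) :
    3 * Set.ncard {P : F[X] |
      P.Monic ∧ P.natDegree = 3 ∧ Irreducible P ∧ Condition1 (2 * m + 1) 3 P} =
      (2 * m + 1) * (2 * m) ^ 2 * (2 * m + 2) := by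
  classical
  have hW3 := h.three_mul_card_noncubes
  set W := Finset.univ.filter fun w : F => ∀ z, z ^ 3 ≠ w with hWdef
  have hW : ∀ w, w ∈ W ↔ ∀ z, z ^ 3 ≠ w := by simp [hWdef]
  have hanti : ∀ {a b}, b * σ a = 1 → a * σ b = 1 := by
    intro a b ha
    rw [← h.involutive a, ← map_mul, mul_comm, ha, map_one]
  have hμ := h.card_norm_one
  set μ := Finset.univ.filter fun u : F => u * σ u = 1 with hμdef
  obtain ⟨S, hSmem⟩ : ∃ S : Finset (F × F), ∀ x, x ∈ S ↔ x.1 ≠ x.2 ∧ x.2 * σ x.1 = 1 :=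
    ⟨Finset.univ.filter fun x => x.1 ≠ x.2 ∧ x.2 * σ x.1 = 1, by simp⟩
  have hScard : S.card = Fintype.card F - 1 - (2 * m + 2) := by
    have hsub : μ ⊆ Finset.univ.erase 0 := by
      intro u hu
      rw [Finset.mem_erase]
      exact ⟨left_ne_zero_of_mul_eq_one (Finset.mem_filter.1 hu).2, Finset.mem_univ _⟩
    rw [← hμ, ← Finset.card_univ, ← Finset.card_erase_of_mem (Finset.mem_univ (0 : F)),
      ← Finset.card_sdiff_of_subset hsub]
    refine Finset.card_bij (fun x _ => x.1) ?_ ?_ ?_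
    · rintro ⟨a, b⟩ hx
      obtain ⟨hab, ha⟩ := (hSmem _).1 hx
      have hσa := right_ne_zero_of_mul_eq_one ha
      simp only [Finset.mem_sdiff, Finset.mem_erase, Finset.mem_univ, and_true, hμdef,
        Finset.mem_filter, true_and]
      exact ⟨(map_ne_zero σ).1 hσa, fun h0 => hab (mul_right_cancel₀ hσa (h0.trans ha.symm))⟩
    · rintro ⟨a, b⟩ hx ⟨a', b'⟩ hy (rfl : a = a')
      have ha := ((hSmem _).1 hx).2
      have ha' := ((hSmem _).1 hy).2
      exact Prod.ext rfl (mul_right_cancel₀ (right_ne_zero_of_mul_eq_one ha) (ha.trans ha'.symm))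
    · intro a ha
      simp only [Finset.mem_sdiff, Finset.mem_erase, Finset.mem_univ, and_true, hμdef,
        Finset.mem_filter, true_and] at ha
      have hσa : σ a ≠ 0 := (map_ne_zero σ).2 ha.1
      refine ⟨(a, (σ a)⁻¹), (hSmem _).2 ⟨fun h0 => ha.2 ?_, inv_mul_cancel₀ hσa⟩, rfl⟩
      exact (congrArg (· * σ a) h0).trans (inv_mul_cancel₀ hσa)
  have hset : {P : F[X] |
      P.Monic ∧ P.natDegree = 3 ∧ Irreducible P ∧ Condition1 (2 * m + 1) 3 P} =
      ((S ×ˢ W).image fun x => splitHessianCubic x.1.1 x.1.2 x.2) ∪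
        W.image fun w => X ^ 3 - C w := by
    ext P
    simp only [Set.mem_ofPred_eq, Finset.coe_union, Finset.coe_image, Set.mem_union, Set.mem_image,
      Finset.mem_coe, Finset.mem_product, Prod.exists]
    constructor
    · rintro ⟨hP, hdeg, hirr, hcond⟩
      rcases h.eq_splitHessianCubic_or_eq_X_pow_three_sub_C hP hdeg hirr hcond with
        ⟨a, b, w, hab, hw, rfl, ⟨ha, hb⟩ | ha⟩ | ⟨w, hw, rfl⟩
      · exact absurd hcond (h.not_condition1_splitHessianCubic_of_diag hq hab ha hb)
      · exact Or.inl ⟨a, b, w, ⟨(hSmem _).2 ⟨hab, ha⟩, (hW w).2 hw⟩, rfl⟩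
      · exact Or.inr ⟨w, (hW w).2 hw, rfl⟩
    · rintro (⟨a, b, w, ⟨hab, hw⟩, rfl⟩ | ⟨w, hw, rfl⟩)
      · obtain ⟨hab, ha⟩ := (hSmem _).1 hab
        rw [hW] at hw
        have hw1 := ne_one_of_forall_pow_three_ne hw
        exact ⟨monic_splitHessianCubic hw1 a b, natDegree_splitHessianCubic hw1 a b,
          irreducible_splitHessianCubic hab hw,
          h.condition1_splitHessianCubic_of_antidiag hq hw hab ha⟩
      · rw [hW] at hw
        exact ⟨monic_X_pow_sub_C w (Nat.succ_ne_zero 2), natDegree_X_pow_sub_C,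
          irreducible_X_pow_three_sub_C hw, h.condition1_X_pow_three_sub_C hq hw⟩
  have hcount := h.two_mul_card_image_splitHessianCubic (S := S) (W := W)
    (fun x hx => ((hSmem x).1 hx).1)
    (fun x hx => (hSmem _).2 ⟨((hSmem x).1 hx).1.symm, hanti ((hSmem x).1 hx).2⟩) hW
  have hdisj : Disjoint ((S ×ˢ W).image fun x => splitHessianCubic x.1.1 x.1.2 x.2)
      (W.image fun w => (X ^ 3 - C w : F[X])) := by
    rw [Finset.disjoint_left]
    intro P h1 h2
    obtain ⟨x, hx, rfl⟩ := Finset.mem_image.1 h1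
    obtain ⟨w, hw, hP⟩ := Finset.mem_image.1 h2
    obtain ⟨hab, hw⟩ := Finset.mem_product.1 hx
    rw [hW] at hw
    exact h.splitHessianCubic_ne_X_pow_three_sub_C ((hSmem _).1 hab).1
      (ne_zero_of_forall_pow_three_ne hw) (ne_one_of_forall_pow_three_ne hw) hP.symm
  have hinj : (W.image fun w => (X ^ 3 - C w : F[X])).card = W.card :=
    Finset.card_image_of_injective _ fun w w' H => C_injective (sub_right_injective H)
  rw [hset, Set.ncard_coe_finset, Finset.card_union_of_disjoint hdisj, hinj]
  have e2 : (2 * m + 1) ^ 2 - 1 = 2 * m * (2 * m + 2) := by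
    rw [Nat.sub_eq_iff_eq_add (Nat.one_le_pow _ _ (by omega))]
    ring
  have e1 : S.card + (2 * m + 2) = 2 * m * (2 * m + 2) := by
    rw [hScard, hcard, e2]
    have := h.two_le
    exact Nat.sub_add_cancel (Nat.le_mul_of_pos_left _ (by omega))
  rw [hcard, e2] at hW3
  have e3 : S.card + 2 = (2 * m + 1) * (2 * m) := by
    apply Nat.add_right_cancel (m := 2 * m)
    linear_combination e1
  apply Nat.eq_of_mul_eq_mul_left (Nat.zero_lt_two)
  linear_combination 3 * hcount + (2 * m + 1) * (2 * m) * hW3 + 3 * W.card * e3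

end IsQuadraticFrobenius

theorem isQuadraticFrobenius_iterateFrobenius {p n m : ℕ} (hp : p.Prime) (hp3 : 3 < p)
    (hm : 2 * m + 1 = p ^ n) (hn : n ≠ 0) {F : Type*} [Field F] [Fintype F] [CharP F p]
    [ExpChar F p] (hF : Fintype.card F = (2 * m + 1) ^ 2) :
    IsQuadraticFrobenius p m (iterateFrobenius F p n) := by
  have hp5 : 5 ≤ p := by
    by_contra!
    obtain rfl : p = 4 := by omega
    exact absurd hp (by norm_num)
  have happly : ∀ x : F, iterateFrobenius F p n x = x ^ (2 * m + 1) := fun x => by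
    rw [iterateFrobenius_def, hm]
  have hm2 : 2 ≤ m := by
    have := Nat.le_self_pow hn p
    omega
  have hunits : Nat.card Fˣ = 2 * m * (2 * m + 2) := by
    rw [Nat.card_units, Nat.card_eq_fintype_card, hF,
      Nat.sub_eq_iff_eq_add (Nat.one_le_pow _ _ (by omega))]
    ring
  refine ⟨inferInstance, hp5, hm2, ⟨n, hm⟩, hp, happly, fun x => ?_, ?_, fun x hx => ?_⟩
  · rw [happly, happly, ← pow_mul, ← sq, ← hF, FiniteField.pow_card]
  · obtain ⟨g, hg⟩ := IsCyclic.exists_ofOrder_eq_natCard (α := Fˣ)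
    refine ⟨(g ^ (2 * m) : Fˣ), IsPrimitiveRoot.coe_units_iff.2 ?_⟩
    have : orderOf (g ^ (2 * m)) = 2 * m + 2 := by
      rw [orderOf_pow_of_dvd (by omega) (by rw [hg, hunits]; exact dvd_mul_right _ _), hg, hunits,
        Nat.mul_div_cancel_left _ (by omega)]
    rw [← this]
    exact IsPrimitiveRoot.orderOf _
  · by_cases hx0 : x = 0
    · exact ⟨0, by rw [hx0]; ring⟩
    have hchar : ringChar F ≠ 2 := by
      rw [ringChar.eq F p]
      omega
    obtain ⟨t, ht⟩ := (FiniteField.isSquare_iff hchar hx0).2 (by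
      rw [happly, pow_succ] at hx
      have h1 : x ^ (2 * m) = 1 := mul_right_cancel₀ hx0 (by rw [hx, one_mul])
      have h2 : Fintype.card F / 2 = 2 * m * (m + 1) := by
        rw [hF]
        have : (2 * m + 1) ^ 2 = 2 * (2 * m * (m + 1)) + 1 := by ring
        omega
      rw [h2, pow_mul, h1, one_pow])
    exact ⟨t, by rw [ht, sq]⟩

/-- Corollary: the number of monic irreducible cubics over `𝔽_{q²}` satisfying
Condition (1) is `q(q−1)²(q+1)/3` if `q ≡ 1 (mod 3)` and `q(q−1)(q+1)²/3` if
`q ≡ 2 (mod 3)`. -/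
theorem statement16 (p n q : ℕ) (hp : p.Prime) (hp3 : 3 < p) (hn : n ≠ 0) (hq : q = p ^ n)
    (F : Type*) [Field F] [Fintype F] (hF : Fintype.card F = q ^ 2) :
    (q % 3 = 1 →
      3 * Set.ncard {P : Polynomial F |
          P.Monic ∧ P.natDegree = 3 ∧ Irreducible P ∧ Condition1 q 3 P} =
        q * (q - 1) ^ 2 * (q + 1)) ∧
    (q % 3 = 2 →
      3 * Set.ncard {P : Polynomial F |
          P.Monic ∧ P.natDegree = 3 ∧ Irreducible P ∧ Condition1 q 3 P} =
        q * (q - 1) * (q + 1) ^ 2) := by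
  obtain ⟨m, hm⟩ : ∃ m, q = 2 * m + 1 := hq ▸ ((hp.odd_of_ne_two (by omega)).pow : Odd (p ^ n))
  have : Fact p.Prime := ⟨hp⟩
  have : CharP F p := charP_of_card_eq_prime_pow (f := n * 2) (by rw [hF, hq, pow_mul])
  have : ExpChar F p := .prime hp
  have hF' := hF
  rw [hm] at hF'
  have h := isQuadraticFrobenius_iterateFrobenius hp hp3 (hm.symm.trans hq) hn hF'
  subst hm
  exact ⟨h.three_mul_ncard_of_mod_eq_one hF, h.three_mul_ncard_of_mod_eq_two hF⟩
end
end

section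
/- Let F_1(x) = x^{q^2+1} + x + 1 ∈ F_{q^2}[x]. For u, v ∈ F_{q^2} with u^{q+1} ≠ v^{q+1}, define the polynomial F_1^{(u,v)}(x) = (v + u^q x)^{q^2+1} + (v + u^q x)(u + v^q x)^{q^2} + (u + v^q x)^{q^2+1} ∈ F_{q^2}[x]. Then there exists a nonzero scalar c ∈ F_{q^2} with F_1^{(u,v)}(x) = c·F_1(x) if and only if v = u^q − u, u ≠ 0, and u^{2(q−1)} − u^{q−1} + 1 ≠ 0. -/
noncomputable section

open Polynomial

/-- The linear polynomial `a + b x` raised to the power `|F|`. -/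
theorem C_add_C_mul_X_pow_card {F : Type*} [Field F] [Fintype F] (a b : F) :
    (C a + C b * X : F[X]) ^ Fintype.card F = C a + C b * X ^ Fintype.card F := by
  obtain ⟨p, hp⟩ := CharP.exists F
  obtain ⟨k, hpp, hk⟩ := FiniteField.card F p
  have : Fact p.Prime := ⟨hpp⟩
  have key : (C a + C b * X : F[X]) ^ Fintype.card F =
      C a ^ Fintype.card F + (C b * X) ^ Fintype.card F := by
    rw [hk]; exact add_pow_char_pow (C a) (C b * X) _ _
  rw [key, mul_pow, ← C_pow, ← C_pow, FiniteField.pow_card, FiniteField.pow_card]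

/-- The action of a matrix with entries `u, v, U, V` on `x ^ (|F| + 1) + x + 1`, expanded. -/
theorem transform_eq_of_card {F : Type*} [Field F] [Fintype F] {m : ℕ} (hm : Fintype.card F = m)
    (u v U V : F) :
    (C v + C U * X) ^ (m + 1) + (C v + C U * X) * (C u + C V * X) ^ m +
        (C u + C V * X) ^ (m + 1) =
      C (U ^ 2 + U * V + V ^ 2) * (X : F[X]) ^ (m + 1) + C (v * U + u * V + v * V) * X ^ m +
        C (v * U + u * U + u * V) * X + C (u ^ 2 + u * v + v ^ 2) := by
  subst hm
  simp only [pow_succ _ (Fintype.card F), C_add_C_mul_X_pow_card]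
  simp only [C_add, C_mul, C_pow]
  ring

/-- The lower coefficients of a four-term polynomial proportional to `x ^ (m + 1) + x + 1`. -/
theorem coeffs_of_eq_C_mul {R : Type*} [CommRing R] {m : ℕ} (hm : 2 ≤ m) {a b d e c : R}
    (h : C a * (X : R[X]) ^ (m + 1) + C b * X ^ m + C d * X + C e =
      C c * (X ^ (m + 1) + X + 1)) :
    b = 0 ∧ d = c ∧ e = c := by
  have hm0 : m ≠ 0 := by omega
  have hm1 : m ≠ 1 := by omega
  have h0 := congrArg (coeff · 0) h
  have h1 := congrArg (coeff · 1) h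
  have h2 := congrArg (coeff · m) h
  simp only [coeff_add, coeff_C_mul, coeff_X_pow, coeff_X, coeff_C, coeff_one] at h0 h1 h2
  simp [hm0, hm0.symm, hm1.symm] at h0 h1 h2
  exact ⟨h2, h1, h0⟩

/-- Lemma: the Dickson matrix `φ_{u,v}` (with `u^{q+1} ≠ v^{q+1}`) stabilises
`F₁(x) = x^{q²+1} + x + 1` up to a nonzero scalar if and only if `v = u^q − u`, `u ≠ 0`
and `u^{2(q−1)} − u^{q−1} + 1 ≠ 0`. -/
theorem statement17 (p n q : ℕ) (hp : p.Prime) (hp3 : 3 < p) (hn : n ≠ 0) (hq : q = p ^ n)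
    (F : Type*) [Field F] [Fintype F] (hF : Fintype.card F = q ^ 2)
    (u v : F) (huv : u ^ (q + 1) ≠ v ^ (q + 1)) :
    (∃ c : F, c ≠ 0 ∧
        (C v + C (u ^ q) * X) ^ (q ^ 2 + 1) +
            (C v + C (u ^ q) * X) * (C u + C (v ^ q) * X) ^ (q ^ 2) +
            (C u + C (v ^ q) * X) ^ (q ^ 2 + 1) =
          C c * ((X : Polynomial F) ^ (q ^ 2 + 1) + X + 1)) ↔
      (v = u ^ q - u ∧ u ≠ 0 ∧ u ^ (2 * (q - 1)) - u ^ (q - 1) + 1 ≠ 0) := by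
  have hq1 : 1 ≤ q := hq ▸ Nat.pow_pos hp.pos
  have hq2 : 2 ≤ q ^ 2 := hF ▸ Fintype.one_lt_card
  have : Fact p.Prime := ⟨hp⟩
  have : CharP F p := charP_of_card_eq_prime_pow (f := n * 2) (by rw [hF, hq, pow_mul])
  rw [transform_eq_of_card hF]
  have hfrob (x : F) : (x ^ q) ^ q = x := by
    rw [← pow_mul, ← sq, ← hF, FiniteField.pow_card]
  have hpow : u ^ (2 * (q - 1)) * u ^ 2 = (u ^ q) ^ 2 ∧ u ^ (q - 1) * u ^ 2 = u * u ^ q := by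
    obtain ⟨k, rfl⟩ := Nat.exists_eq_add_of_le' hq1
    simp only [Nat.add_sub_cancel]
    constructor <;> ring
  have hnorm : (u ^ (2 * (q - 1)) - u ^ (q - 1) + 1) * u ^ 2 =
      (u ^ q) ^ 2 - u * u ^ q + u ^ 2 := by
    linear_combination hpow.1 - hpow.2
  have hdet : u * u ^ q - v * v ^ q ≠ 0 := by
    rw [← pow_succ', ← pow_succ']
    exact sub_ne_zero.mpr huv
  have hconj : v = u ^ q - u → v ^ q = u - u ^ q := by
    rintro rfl
    rw [hq, sub_pow_char_pow, ← hq, hfrob]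
  constructor
  · rintro ⟨c, -, h⟩
    obtain ⟨hm, h1, h0⟩ := coeffs_of_eq_C_mul hq2 h
    have hv : v = u ^ q - u := by
      refine sub_eq_zero.mp ((mul_eq_zero.mp ?_).resolve_left hdet)
      linear_combination u ^ q * (h0 - h1) + (u ^ q - v) * hm
    have hu : u ≠ 0 := by
      rintro rfl
      apply hdet
      simp [hv, Nat.ne_of_gt hq1]
    refine ⟨hv, hu, fun h3 => hdet ?_⟩
    rw [h3, zero_mul] at hnorm
    rw [hconj hv, hv]
    linear_combination -hnorm
  · rintro ⟨hv, hu, h3⟩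
    refine ⟨_, mul_ne_zero h3 (pow_ne_zero 2 hu), ?_⟩
    rw [hnorm, hconj hv, hv]
    simp only [C_add, C_sub, C_mul, C_pow]
    ring
end
end

section
/- Let δ ∈ F_{q^2} and suppose both P_{δ,1}(x) and P_{δ^q,1}(x) are irreducible in F_{q^2}[x] and satisfy Condition (1). Then P_{δ,1} and P_{δ^q,1} are projectively equivalent: there exist λ, u, v ∈ F_{q^2} with λ ≠ 0 and u^{q+1} ≠ v^{q+1} such that P_{δ^q,1}(x) = λ·(u + v^q x)^3 · P_{δ,1}((v + u^q x)/(u + v^q x)) as polynomials. -/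
noncomputable section

open Polynomial

/-- The cubic `P_{δ,1}(x) = x³ − δx² − (δ+3)x − 1`. -/
def Pd1 {F : Type*} [Field F] (δ : F) : Polynomial F :=
  X ^ 3 - C δ * X ^ 2 - C (δ + 3) * X - 1

/-- For a cubic `P`, the polynomial `(u + v^q x)³ · P((v + u^q x)/(u + v^q x))`. -/
def moebius3 {F : Type*} [Field F] (q : ℕ) (u v : F) (P : Polynomial F) : Polynomial F :=
  ∑ i ∈ Finset.range 4,
    C (P.coeff i) * (C v + C (u ^ q) * X) ^ i * (C u + C (v ^ q) * X) ^ (3 - i)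

theorem cubic_homogeneous_eq_sub_cubes {R : Type*} [CommRing R] {w : R} (hw : w ^ 2 + w + 1 = 0)
    (d N D : R) :
    3 * (w - w ^ 2) * (N ^ 3 - d * N ^ 2 * D - (d + 3) * N * D ^ 2 - D ^ 3) =
      (d - 3 * w ^ 2) * (N - w * D) ^ 3 - (d - 3 * w) * (N - w ^ 2 * D) ^ 3 := by
  have hw2 : w ^ 2 = -w - 1 := by linear_combination hw
  rw [hw2]
  linear_combination -(2 * w + 1) * (9 * N * D ^ 2 - d * D ^ 3 + 3 * D ^ 3) * hw

theorem sub_sq_ne_zero_of_sq_add_self_add_one {R : Type*} [CommRing R] (h3 : (3 : R) ≠ 0) {w : R}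
    (hw : w ^ 2 + w + 1 = 0) : w - w ^ 2 ≠ 0 := fun h =>
  h3 (by linear_combination (3 - 2 * w) * hw - (2 * w + 1) * h)

theorem moebius3_Pd1 {F : Type*} [Field F] (q : ℕ) (u v δ : F) :
    moebius3 q u v (Pd1 δ) =
      (C v + C (u ^ q) * X) ^ 3
        - C δ * (C v + C (u ^ q) * X) ^ 2 * (C u + C (v ^ q) * X)
        - (C δ + 3) * (C v + C (u ^ q) * X) * (C u + C (v ^ q) * X) ^ 2
        - (C u + C (v ^ q) * X) ^ 3 := by
  have h0 : (Pd1 δ).coeff 0 = -1 := by simp [Pd1]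
  have h1 : (Pd1 δ).coeff 1 = -(δ + 3) := by
    simp only [Pd1, coeff_sub, coeff_C_mul, coeff_X_pow, coeff_X, coeff_one]
    norm_num
  have h2 : (Pd1 δ).coeff 2 = -δ := by
    simp only [Pd1, coeff_sub, coeff_C_mul, coeff_X_pow, coeff_X, coeff_one]
    norm_num
  have h3 : (Pd1 δ).coeff 3 = 1 := by
    simp only [Pd1, coeff_sub, coeff_C_mul, coeff_X_pow, coeff_X, coeff_one]
    norm_num
  have hC3 : (C (3 : F)) = 3 := rfl
  simp only [moebius3, Finset.sum_range_succ, Finset.sum_range_zero, h0, h1, h2, h3,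
    C_neg, C_add, C_1, hC3]
  ring

theorem exists_moebius3_of_cube_root {F : Type*} [Field F] (h3 : (3 : F) ≠ 0) (q : ℕ)
    {w c s δ e : F} (hw : w ^ 2 + w + 1 = 0) (hc : c ≠ 0) (hs : s ≠ 0)
    (hv : (s * (c - 1)) ^ q = s * (1 - c))
    (hu : (s * (c * w - w ^ 2)) ^ q = s * (w - w ^ 2 * c))
    (hδ : δ - 3 * w ≠ 0) (he : e - 3 * w ≠ 0)
    (h : c ^ 3 * (δ - 3 * w ^ 2) * (e - 3 * w) = (e - 3 * w ^ 2) * (δ - 3 * w)) :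
    ∃ lam u v : F, lam ≠ 0 ∧ u ^ (q + 1) ≠ v ^ (q + 1) ∧
      Pd1 e = C lam * moebius3 q u v (Pd1 δ) := by
  have hww := sub_sq_ne_zero_of_sq_add_self_add_one h3 hw
  have hlam : (e - 3 * w) / ((δ - 3 * w) * (s * (w - w ^ 2)) ^ 3) ≠ 0 :=
    div_ne_zero he (mul_ne_zero hδ (pow_ne_zero _ (mul_ne_zero hs hww)))
  have hlam1 : (e - 3 * w) / ((δ - 3 * w) * (s * (w - w ^ 2)) ^ 3) *
      ((δ - 3 * w) * (s * (w - w ^ 2)) ^ 3) = e - 3 * w :=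
    div_mul_cancel₀ _ (mul_ne_zero hδ (pow_ne_zero _ (mul_ne_zero hs hww)))
  generalize (e - 3 * w) / ((δ - 3 * w) * (s * (w - w ^ 2)) ^ 3) = lam at hlam hlam1
  have hlam2 : lam * (δ - 3 * w ^ 2) * (s * c * (w - w ^ 2)) ^ 3 = e - 3 * w ^ 2 := by
    apply mul_right_cancel₀ hδ
    rw [← h, ← hlam1]
    ring
  have hlam1' : lam * (δ - 3 * w) * (s * (w - w ^ 2)) ^ 3 = e - 3 * w := by
    rw [← hlam1]; ring
  refine ⟨lam, s * (c * w - w ^ 2), s * (c - 1), hlam, ?_, ?_⟩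
  · rw [pow_succ _ q, pow_succ _ q, hu, hv]
    intro h0
    have : 3 * (s ^ 2 * c) = 0 := by
      linear_combination -h0 + (s ^ 2 * (c * (w ^ 2 - w + 1) - (c ^ 2 + 1) * (w - 1))) * hw
    simp_all
  · rw [moebius3_Pd1, hu, hv]
    have hW : (C w : F[X]) ^ 2 + C w + 1 = 0 := by
      rw [← C_pow, ← C_add, ← C_1, ← C_add, hw, C_0]
    have hC3 : (C (3 : F)) = 3 := rfl
    have hne : (3 * (C w - C w ^ 2) : F[X]) ≠ 0 := by
      rw [← hC3, ← C_pow, ← C_sub, ← C_mul, Ne, C_eq_zero]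
      exact mul_ne_zero h3 hww
    apply mul_left_cancel₀ hne
    have key := cubic_homogeneous_eq_sub_cubes hW (C e) X 1
    have hP : Pd1 e = X ^ 3 - C e * X ^ 2 * 1 - (C e + 3) * X * 1 ^ 2 - 1 ^ 3 := by
      simp [Pd1, hC3]
    rw [hP, key, mul_left_comm, cubic_homogeneous_eq_sub_cubes hW]
    have hN1 : (C (s * (c - 1)) + C (s * (w - w ^ 2 * c)) * X : F[X])
        - C w * (C (s * (c * w - w ^ 2)) + C (s * (1 - c)) * X) =
        C (s * c * (w - w ^ 2)) * (X - C w) := by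
      simp only [C_mul, C_sub, C_pow, C_1]
      linear_combination (C s * (1 - C w) * (C c - 1)) * hW
    have hN2 : (C (s * (c - 1)) + C (s * (w - w ^ 2 * c)) * X : F[X])
        - C w ^ 2 * (C (s * (c * w - w ^ 2)) + C (s * (1 - c)) * X) =
        C (s * (w - w ^ 2)) * (X - C w ^ 2) := by
      simp only [C_mul, C_sub, C_pow, C_1]
      linear_combination (C s * (C c - 1) * (1 - C w)) * hW
    rw [hN1, hN2, mul_pow, mul_pow, ← C_pow, ← C_pow]
    have e1 := congrArg (C : F → F[X]) hlam1'
    have e2 := congrArg (C : F → F[X]) hlam2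
    simp only [C_mul, C_sub, C_pow, hC3] at e1 e2 ⊢
    linear_combination (X - C w ^ 2) ^ 3 * e1 - (X - C w) ^ 3 * e2

theorem exists_sq_add_self_add_one_eq_zero {F : Type*} [Field F] [Fintype F]
    (h : 3 ∣ Fintype.card F - 1) : ∃ w : F, w ^ 2 + w + 1 = 0 := by
  classical
  have : Fact (Nat.Prime 3) := ⟨Nat.prime_three⟩
  obtain ⟨g, hg⟩ := exists_prime_orderOf_dvd_card (G := Fˣ) 3 (by rwa [Fintype.card_units])
  have h1 : g ≠ 1 := by rintro rfl; simp at hg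
  have h3 : (g : F) ^ 3 = 1 := by
    rw [← Units.val_pow_eq_pow_val, ← hg, pow_orderOf_eq_one, Units.val_one]
  refine ⟨g, mul_left_cancel₀ (sub_ne_zero.2 fun h => h1 (Units.ext h)) ?_⟩
  rw [Units.val_one]
  linear_combination h3

theorem eval_ne_zero_of_irreducible_Pd1 {F : Type*} [Field F] {δ : F} (h : Irreducible (Pd1 δ))
    (x : F) : (Pd1 δ).eval x ≠ 0 := by
  have hd : (Pd1 δ).natDegree = 3 := by
    unfold Pd1
    compute_degree!
  intro hx
  have := natDegree_eq_of_degree_eq_some (n := 1) (degree_eq_one_of_irreducible_of_root h hx)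
  omega

/-- Lemma: if `P_{δ,1}` and `P_{δ^q,1}` are irreducible and satisfy Condition (1), then
they are projectively equivalent. -/
theorem statement18 (p n q : ℕ) (hp : p.Prime) (hp3 : 3 < p) (hn : n ≠ 0) (hq : q = p ^ n)
    (F : Type*) [Field F] [Fintype F] (hF : Fintype.card F = q ^ 2)
    (δ : F) (h1 : Irreducible (Pd1 δ)) (h2 : Irreducible (Pd1 (δ ^ q)))
    (hc1 : Condition1 q 3 (Pd1 δ)) (hc2 : Condition1 q 3 (Pd1 (δ ^ q))) :
    ∃ lam u v : F, lam ≠ 0 ∧ u ^ (q + 1) ≠ v ^ (q + 1) ∧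
      Pd1 (δ ^ q) = C lam * moebius3 q u v (Pd1 δ) := by
  have : Fact p.Prime := ⟨hp⟩
  have : CharP F p := charP_of_card_eq_prime_pow (f := n * 2) (by rw [hF, hq, pow_mul])
  let φ : F →+* F := iterateFrobenius F p n
  have hφ (x : F) : x ^ q = φ x := by rw [hq]; rfl
  have hφφ (x : F) : φ (φ x) = x := by
    rw [← hφ, ← hφ, ← pow_mul, ← sq, ← hF, FiniteField.pow_card]
  have h3 : (3 : F) ≠ 0 := by
    intro h
    have := (CharP.cast_eq_zero_iff F p 3).1 (by exact_mod_cast h)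
    have := Nat.le_of_dvd (by norm_num) this
    omega
  have hq3 : q % 3 = 1 ∨ q % 3 = 2 := by
    have : ¬ 3 ∣ q := by
      rw [hq]
      intro h
      have := (Nat.prime_dvd_prime_iff_eq Nat.prime_three hp).1 (Nat.prime_three.dvd_of_dvd_pow h)
      omega
    omega
  obtain ⟨w, hw⟩ := exists_sq_add_self_add_one_eq_zero (F := F) (by
    rw [hF]
    have : q ^ 2 % 3 = 1 := by rcases hq3 with h | h <;> simp [Nat.pow_mod, h]
    omega)
  have hw3 : w ^ 3 = 1 := by linear_combination (w - 1) * hw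
  have hne {d z : F} (h : Irreducible (Pd1 d)) (hz : z ^ 2 + z + 1 = 0) : d - 3 * z ≠ 0 := by
    intro h0
    obtain rfl : d = 3 * z := by linear_combination h0
    apply eval_ne_zero_of_irreducible_Pd1 h z
    simp only [Pd1, eval_sub, eval_mul, eval_pow, eval_X, eval_C, eval_one]
    linear_combination (-2 * z - 1) * hz
  have hw' : (w ^ 2) ^ 2 + w ^ 2 + 1 = 0 := by linear_combination (w ^ 2 - w + 1) * hw
  have hA := hne h1 hw
  have hB := hne h1 hw'
  have hA' := hne h2 hw
  rw [hφ] at hA' ⊢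
  rcases hq3 with hm | hm
  · have hφw : φ w = w := by
      rw [← hφ, ← Nat.div_add_mod q 3, hm, pow_add, pow_mul, hw3, one_pow, one_mul, pow_one]
    obtain ⟨k, hk⟩ : ∃ k, q + 2 = 3 * k := ⟨(q + 2) / 3, by omega⟩
    have hτ : (δ - 3 * w ^ 2) / (δ - 3 * w) ≠ 0 := div_ne_zero hB hA
    obtain ⟨τ, hτd⟩ : ∃ τ, τ = (δ - 3 * w ^ 2) / (δ - 3 * w) := ⟨_, rfl⟩
    rw [← hτd] at hτ
    have hφτ : φ τ = (φ δ - 3 * w ^ 2) / (φ δ - 3 * w) := by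
      simp [hτd, hφw, map_ofNat]
    have hs : τ ^ k ≠ 0 := pow_ne_zero _ hτ
    have hs3 : (τ ^ k) ^ 3 = φ τ * τ ^ 2 := by
      rw [← pow_mul, mul_comm k, ← hk, pow_add, hφ]
    obtain ⟨s, hsd⟩ : ∃ s, s = τ ^ k := ⟨_, rfl⟩
    rw [← hsd] at hs hs3
    have hφs : φ s ≠ 0 := (map_ne_zero φ).2 hs
    have hφτ0 : φ τ ≠ 0 := (map_ne_zero φ).2 hτ
    have hc3 : (φ s / s) ^ 3 * τ = φ τ := by
      have := congrArg φ hs3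
      simp only [map_pow, map_mul, hφφ] at this
      rw [div_pow, this, hs3]
      field_simp
    refine exists_moebius3_of_cube_root h3 q hw (div_ne_zero hφs hs) hs ?_ ?_ hA hA' ?_
    · rw [hφ]
      simp only [map_mul, map_sub, map_div₀, map_one, hφφ]
      field_simp
    · rw [hφ]
      simp only [map_mul, map_sub, map_div₀, map_pow, hφφ, hφw]
      field_simp
    · rw [hφτ, hτd] at hc3
      field_simp at hc3 ⊢
      linear_combination hc3
  · have hφw : φ w = w ^ 2 := by
      rw [← hφ, ← Nat.div_add_mod q 3, hm, pow_add, pow_mul, hw3, one_pow, one_mul]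
    have hφw2 : φ (w ^ 2) = w := by
      rw [map_pow, hφw]; linear_combination w * hw3
    obtain ⟨k, hk⟩ : ∃ k, 2 * q = 3 * k + 1 := ⟨(2 * q) / 3, by omega⟩
    have hτ : (δ - 3 * w) / (δ - 3 * w ^ 2) ≠ 0 := div_ne_zero hA hB
    obtain ⟨τ, hτd⟩ : ∃ τ, τ = (δ - 3 * w) / (δ - 3 * w ^ 2) := ⟨_, rfl⟩
    rw [← hτd] at hτ
    have hφτ : φ τ = (φ δ - 3 * w ^ 2) / (φ δ - 3 * w) := by
      rw [hτd, map_div₀, map_sub, map_sub, map_mul, map_mul, hφw2, hφw, map_ofNat]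
    have hφτ0 : φ τ ≠ 0 := (map_ne_zero φ).2 hτ
    have hN : τ * φ τ ≠ 0 := mul_ne_zero hτ hφτ0
    have hφN : φ (τ * φ τ) = τ * φ τ := by rw [map_mul, hφφ, mul_comm]
    have hc3 : ((τ * φ τ) ^ k) ^ 3 = τ * φ τ := by
      apply mul_right_cancel₀ hN
      rw [← pow_mul, ← pow_succ, mul_comm k, ← hk, pow_mul', hφ, hφN, sq]
    have hφc : φ ((τ * φ τ) ^ k) = (τ * φ τ) ^ k := by rw [map_pow, hφN]
    have hww := sub_sq_ne_zero_of_sq_add_self_add_one h3 hw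
    refine exists_moebius3_of_cube_root h3 q hw (pow_ne_zero k hN) hww ?_ ?_ hA hA' ?_
    · rw [hφ, map_mul, map_sub, map_sub, hφc, hφw2, hφw, map_one]
      ring
    · rw [hφ, map_mul, map_sub, map_sub, map_mul, hφc, hφw2, hφw]
      ring
    · rw [hc3, hφτ, hτd]
      field_simp
end
end
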